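/- arXiv:1503.04543 — 3 statements merged into one kernel-verified Lean document; each statement's English description precedes it below -/
import Mathlib

section
/- Let G be a finite group, and for i = 1, 2 let F_i be a free group of finite rank d_i, ε_i : F_i → G a surjective group homomorphism, R_i = ker ε_i, and R_i^{ab} the associated relation module. Then R_1^{ab} ⊕ ℤ[G]^{(d_2)} is isomorphic as a ℤ[G]-module to R_2^{ab} ⊕ ℤ[G]^{(d_1)}, where ℤ[G]^{(m)} denotes the direct sum of m copies of ℤ[G]. -/
namespace RelationModule

open MonoidAlgebra

theorem exists_addMonoidHom_of {G A : Type*} [Group G] [AddCommGroup A] (φ : G → A) :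
    ∃ L : MonoidAlgebra ℤ G →+ A, ∀ g, L (of ℤ G g) = φ g := by
  refine ⟨(Finsupp.liftAddHom fun g => (zmultiplesHom A) (φ g)).comp
    (MonoidAlgebra.coeffAddEquiv (R := ℤ) (M := G)).toAddMonoidHom, fun g => ?_⟩
  simp [of_apply]

theorem addMonoidHom_ext_of {G A : Type*} [Group G] [AddCommGroup A]
    {φ ψ : MonoidAlgebra ℤ G →+ A} (h : ∀ g, φ (of ℤ G g) = ψ (of ℤ G g)) : φ = ψ := by
  refine MonoidAlgebra.addMonoidHom_ext fun g n => ?_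
  have hg : single g n = n • of ℤ G g := by simp [of_apply]
  rw [hg, map_zsmul, map_zsmul, h]

section CrossedHom

variable {G N : Type*} [Group G] [AddCommGroup N] [Module (MonoidAlgebra ℤ G) N]

theorem of_smul_of_smul (g h : G) (n : N) :
    of ℤ G g • of ℤ G h • n = of ℤ G (g * h) • n := by
  rw [smul_smul, map_mul]

theorem of_one_smul (n : N) : of ℤ G 1 • n = n := by
  rw [map_one, one_smul]

section

variable {F : Type*} [Group F] {ε : F →* G} {D : F → N}
  (hD : ∀ f f', D (f * f') = D f + of ℤ G (ε f) • D f')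

include hD

theorem crossedHom_one : D 1 = 0 := by
  have h := hD 1 1
  rw [map_one, of_one_smul, mul_one] at h
  simpa using h

theorem crossedHom_inv (f : F) : D f⁻¹ = -(of ℤ G (ε f⁻¹) • D f) := by
  have h := hD f⁻¹ f
  rw [inv_mul_cancel, crossedHom_one hD] at h
  exact eq_neg_of_add_eq_zero_left h.symm

theorem crossedHom_mul_of_mem_ker {r : F} (hr : r ∈ ε.ker) (f : F) : D (r * f) = D r + D f := by
  rw [hD, MonoidHom.mem_ker.1 hr, of_one_smul]

theorem crossedHom_conj {r : F} (hr : r ∈ ε.ker) (f : F) :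
    D (f * r * f⁻¹) = of ℤ G (ε f) • D r := by
  rw [hD, hD, map_mul, MonoidHom.mem_ker.1 hr, mul_one, crossedHom_inv hD, smul_neg,
    of_smul_of_smul, map_inv, mul_inv_cancel, of_one_smul]
  abel

theorem crossedHom_eq_zero_of_mem_commutator {r : F} (hr : r ∈ ⁅ε.ker, ε.ker⁆) : D r = 0 := by
  let K : Subgroup F :=
    { carrier := {f | f ∈ ε.ker ∧ D f = 0}
      one_mem' := ⟨ε.ker.one_mem, crossedHom_one hD⟩
      mul_mem' := fun {a b} ha hb => ⟨ε.ker.mul_mem ha.1 hb.1, by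
        rw [crossedHom_mul_of_mem_ker hD ha.1, ha.2, hb.2, add_zero]⟩
      inv_mem' := fun {a} ha => ⟨ε.ker.inv_mem ha.1, by
        rw [crossedHom_inv hD, ha.2, smul_zero, neg_zero]⟩ }
  suffices h : ⁅ε.ker, ε.ker⁆ ≤ K from (h hr).2
  refine Subgroup.commutator_le.2 fun a ha b hb => ⟨?_, ?_⟩
  · exact Subgroup.commutator_le_left _ _ (Subgroup.commutator_mem_commutator ha hb)
  · rw [commutatorElement_def, mul_assoc, mul_assoc, crossedHom_mul_of_mem_ker hD ha,
      crossedHom_mul_of_mem_ker hD hb, crossedHom_mul_of_mem_ker hD (ε.ker.inv_mem ha),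
      crossedHom_inv hD, crossedHom_inv hD, ε.map_inv, ε.map_inv, MonoidHom.mem_ker.1 ha,
      MonoidHom.mem_ker.1 hb, inv_one, of_one_smul, of_one_smul]
    abel

theorem crossedHom_eq_add_of_map_eq {f f' : F} (h : ε f = ε f') :
    D f = D (f * f'⁻¹) + D f' := by
  rw [← crossedHom_mul_of_mem_ker hD (by simp [MonoidHom.mem_ker, h]), inv_mul_cancel_right]

end

/-- Crossed homomorphisms on a free group can be prescribed freely on the generators. -/
theorem exists_crossedHom {ι : Type*} (ε : FreeGroup ι →* G) (n : ι → N) :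
    ∃ D : FreeGroup ι → N, (∀ i, D (FreeGroup.of i) = n i) ∧
      ∀ f f', D (f * f') = D f + of ℤ G (ε f) • D f' := by
  let A : FreeGroup ι →* Equiv.Perm N := FreeGroup.lift fun i =>
    { toFun := fun x => of ℤ G (ε (FreeGroup.of i)) • x + n i
      invFun := fun x => of ℤ G (ε (FreeGroup.of i))⁻¹ • (x - n i)
      left_inv := fun x => by
        beta_reduce
        rw [add_sub_cancel_right, of_smul_of_smul, inv_mul_cancel, of_one_smul]
      right_inv := fun x => by
        beta_reduce
        rw [of_smul_of_smul, mul_inv_cancel, of_one_smul, sub_add_cancel] }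
  have hof : ∀ i x, A (FreeGroup.of i) x = of ℤ G (ε (FreeGroup.of i)) • x + n i := fun i x => by
    simp only [A, FreeGroup.lift_apply_of]; rfl
  have hA : ∀ f x, A f x = of ℤ G (ε f) • x + A f 0 := by
    intro f
    induction f using FreeGroup.induction_on with
    | C1 => intro x; simp only [map_one, Equiv.Perm.one_apply, one_smul, add_zero]
    | of i => intro x; rw [hof, hof, smul_zero, zero_add]
    | inv_of i ih =>
      have key : ∀ x, A (FreeGroup.of i)⁻¹ x = of ℤ G (ε (FreeGroup.of i))⁻¹ • (x - n i) := by
        intro x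
        rw [map_inv, Equiv.Perm.inv_eq_iff_eq, hof, of_smul_of_smul, mul_inv_cancel, of_one_smul,
          sub_add_cancel]
      intro x
      rw [key, key, ε.map_inv, ← smul_add, zero_sub, sub_eq_add_neg]
    | mul f f' hf hf' =>
      intro x
      rw [map_mul, Equiv.Perm.mul_apply, Equiv.Perm.mul_apply, hf, hf' x, hf (A f' 0), smul_add,
        of_smul_of_smul, ε.map_mul, add_assoc]
  refine ⟨fun f => A f 0, fun i => ?_, fun f f' => ?_⟩
  · simp only [hof, smul_zero, zero_add]
  · simp only [map_mul, Equiv.Perm.mul_apply]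
    rw [hA, add_comm]

end CrossedHom

section FoxDerivative

variable {G ι : Type*} [Group G] [Fintype ι] [DecidableEq ι] {ε : FreeGroup ι →* G}
  {D : FreeGroup ι → ι → MonoidAlgebra ℤ G}
  (hDof : ∀ i, D (FreeGroup.of i) = Pi.single i 1)
  (hD : ∀ f f', D (f * f') = D f + of ℤ G (ε f) • D f')

include hDof hD

/-- Elements with vanishing Fox derivatives are killed by every coinduced crossed homomorphism. -/
theorem coinduced_crossedHom_eq_zero {M : Type*} [AddCommGroup M] {E : FreeGroup ι → G → M}
    (hE : ∀ f f' g, E (f * f') g = E f g + E f' (g * ε f)) {f : FreeGroup ι} (hf : D f = 0)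
    (g : G) : E f g = 0 := by
  choose L hL using fun (i : ι) (g : G) =>
    exists_addMonoidHom_of fun h => E (FreeGroup.of i) (g * h)
  let Φ : G → (ι → MonoidAlgebra ℤ G) →+ M := fun g =>
    ∑ i, (L i g).comp (Pi.evalAddMonoidHom _ i)
  have hΦ : ∀ g p, Φ g p = ∑ i, L i g (p i) := fun g p => by simp [Φ]
  have hΦsmul : ∀ g h p, Φ g (of ℤ G h • p) = Φ (g * h) p := by
    intro g h p
    rw [hΦ, hΦ]
    refine Finset.sum_congr rfl fun i _ => ?_
    have : (L i g).comp (AddMonoidHom.mulLeft (of ℤ G h)) = L i (g * h) :=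
      addMonoidHom_ext_of fun k => by
        rw [AddMonoidHom.comp_apply, AddMonoidHom.coe_mulLeft, ← map_mul, hL, hL, mul_assoc]
    exact DFunLike.congr_fun this (p i)
  have hE1 : ∀ g, E 1 g = 0 := fun g => by
    have h := hE 1 1 g
    rw [map_one, mul_one, mul_one] at h
    simpa using h
  have hΦD : ∀ f g, Φ g (D f) = E f g := by
    intro f
    induction f using FreeGroup.induction_on with
    | C1 => intro g; rw [crossedHom_one hD, map_zero, hE1]
    | of i =>
      intro g
      rw [hDof, hΦ, Finset.sum_eq_single i]
      · rw [Pi.single_eq_same, ← map_one (of ℤ G), hL, mul_one]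
      · intro j _ hj
        rw [Pi.single_eq_of_ne hj, map_zero]
      · exact fun h => (h (Finset.mem_univ i)).elim
    | inv_of i ih =>
      intro g
      rw [crossedHom_inv hD, map_neg, hΦsmul, ih]
      have h := hE (FreeGroup.of i)⁻¹ (FreeGroup.of i) g
      rw [inv_mul_cancel, hE1] at h
      exact (eq_neg_of_add_eq_zero_left h.symm).symm
    | mul f f' hf hf' => intro g; rw [hD, map_add, hΦsmul, hf, hf', hE]
  rw [← hΦD, hf, map_zero]

/-- If `a` is a relation among the `ε xᵢ - 1`, then `a` is the Fox derivative of an element of the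
kernel of `ε`. -/
theorem mem_of_linearCombination_eq_zero (hε : Function.Surjective ε)
    (K : Submodule (MonoidAlgebra ℤ G) (ι → MonoidAlgebra ℤ G))
    (hK : ∀ r ∈ ε.ker, D r ∈ K) {a : ι → MonoidAlgebra ℤ G}
    (ha : Fintype.linearCombination (MonoidAlgebra ℤ G)
      (fun i => of ℤ G (ε (FreeGroup.of i)) - 1) a = 0) : a ∈ K := by
  choose s hs using hε
  have hmk : ∀ {f f'}, ε f = ε f' → K.mkQ (D f) = K.mkQ (D f') := by
    intro f f' h
    rw [crossedHom_eq_add_of_map_eq hD h, map_add, K.mkQ_apply (D (f * f'⁻¹)),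
      (Submodule.Quotient.mk_eq_zero K).2 (hK _ (by simp [MonoidHom.mem_ker, h])), zero_add]
  obtain ⟨δ, hδ⟩ := exists_addMonoidHom_of fun g => K.mkQ (D (s g))
  have key : ∀ (b : MonoidAlgebra ℤ G) (f : FreeGroup ι),
      δ (b * (of ℤ G (ε f) - 1)) = b • K.mkQ (D f) := by
    intro b f
    have : δ.comp (AddMonoidHom.mulRight (of ℤ G (ε f) - 1)) =
        (AddMonoidHom.flip (smulAddHom (MonoidAlgebra ℤ G) _)) (K.mkQ (D f)) := by
      refine addMonoidHom_ext_of fun h => ?_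
      rw [AddMonoidHom.comp_apply, AddMonoidHom.mulRight_apply, mul_sub, mul_one, ← map_mul,
        map_sub, hδ, hδ, AddMonoidHom.flip_apply, smulAddHom_apply,
        hmk (f' := s h * f) (by rw [hs, map_mul, hs]), hD, hs, map_add, map_smul,
        add_sub_cancel_left]
    exact DFunLike.congr_fun this b
  rw [← K.ker_mkQ, LinearMap.mem_ker]
  calc K.mkQ a = K.mkQ (∑ i, a i • Pi.single i 1) := by
        congr 1
        simpa using pi_eq_sum_univ' a
    _ = ∑ i, δ (a i * (of ℤ G (ε (FreeGroup.of i)) - 1)) := by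
        simp only [map_sum, map_smul, key, hDof]
    _ = 0 := by
        rw [← map_sum, ← map_zero δ, ← ha, Fintype.linearCombination_apply]
        simp only [smul_eq_mul]

end FoxDerivative

theorem range_linearCombination {G ι : Type*} [Group G] [Fintype ι] [DecidableEq ι]
    {ε : FreeGroup ι →* G} (hε : Function.Surjective ε) :
    LinearMap.range (Fintype.linearCombination (MonoidAlgebra ℤ G)
      fun i => of ℤ G (ε (FreeGroup.of i)) - 1) =
    Submodule.span (MonoidAlgebra ℤ G) (Set.range fun g : G => of ℤ G g - 1) := by
  apply le_antisymm
  · rw [Fintype.range_linearCombination, Submodule.span_le]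
    rintro _ ⟨i, rfl⟩
    exact Submodule.subset_span ⟨_, rfl⟩
  · rw [Submodule.span_le]
    rintro _ ⟨g, rfl⟩
    obtain ⟨f, rfl⟩ := hε g
    rw [Fintype.range_linearCombination]
    set S := Submodule.span (MonoidAlgebra ℤ G)
      (Set.range fun i => of ℤ G (ε (FreeGroup.of i)) - 1)
    have hS : ∀ i, of ℤ G (ε (FreeGroup.of i)) - 1 ∈ S := fun i =>
      Submodule.subset_span ⟨i, rfl⟩
    change of ℤ G (ε f) - 1 ∈ S
    induction f using FreeGroup.induction_on with
    | C1 => rw [map_one, map_one, sub_self]; exact S.zero_mem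
    | of i => exact hS i
    | inv_of i ih =>
      have h : of ℤ G (ε (FreeGroup.of i)⁻¹) - 1 =
          -(of ℤ G (ε (FreeGroup.of i)⁻¹) • (of ℤ G (ε (FreeGroup.of i)) - 1)) := by
        rw [smul_eq_mul, mul_sub, mul_one, ← map_mul, ← map_mul, inv_mul_cancel, map_one, map_one,
          neg_sub]
      rw [h]
      exact S.neg_mem (S.smul_mem _ ih)
    | mul f f' hf hf' =>
      have h : of ℤ G (ε (f * f')) - 1 =
          (of ℤ G (ε f) - 1) + of ℤ G (ε f) • (of ℤ G (ε f') - 1) := by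
        rw [smul_eq_mul, mul_sub, mul_one, ← map_mul, ← map_mul]
        abel
      rw [h]
      exact S.add_mem hf (S.smul_mem _ hf')

/-- The exact sequence `0 → R^{ab} → ℤ[G]^ι → ℤ[G]` of a free presentation of `G`. -/
theorem exists_injective_range_eq_ker {G ι M : Type*} [Group G] [Fintype ι] [DecidableEq ι]
    {ε : FreeGroup ι →* G} (hε : Function.Surjective ε)
    [AddCommGroup M] [Module (MonoidAlgebra ℤ G) M] {π : ε.ker → M}
    (hadd : ∀ r s : ε.ker, π (r * s) = π r + π s)
    (hsurj : Function.Surjective π)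
    (hker : ∀ r : ε.ker, π r = 0 ↔ (r : FreeGroup ι) ∈ ⁅ε.ker, ε.ker⁆)
    (hconj : ∀ (f : FreeGroup ι) (r s : ε.ker), (s : FreeGroup ι) = f * r * f⁻¹ →
      π s = of ℤ G (ε f) • π r) :
    ∃ j : M →ₗ[MonoidAlgebra ℤ G] (ι → MonoidAlgebra ℤ G), Function.Injective j ∧
      LinearMap.range j = LinearMap.ker (Fintype.linearCombination (MonoidAlgebra ℤ G)
        fun i => of ℤ G (ε (FreeGroup.of i)) - 1) := by
  obtain ⟨D, hDof, hD⟩ := exists_crossedHom ε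
    fun i => (Pi.single i 1 : ι → MonoidAlgebra ℤ G)
  obtain ⟨s, hs⟩ := hε.hasRightInverse
  choose σ hσ using hsurj
  have hwd : ∀ r r' : ε.ker, π r = π r' → D r = D r' := by
    intro r r' h
    have h0 : π (r * r'⁻¹) = 0 := by
      have h1 := hadd (r * r'⁻¹) r'
      rw [inv_mul_cancel_right, h] at h1
      simpa using h1
    have h2 := crossedHom_eq_zero_of_mem_commutator hD ((hker _).1 h0)
    rw [crossedHom_eq_add_of_map_eq hD (f' := (r' : FreeGroup ι))
      (by rw [MonoidHom.mem_ker.1 r.2, MonoidHom.mem_ker.1 r'.2])]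
    simpa using h2
  have hσD : ∀ r : ε.ker, D (σ (π r)) = D r := fun r => hwd _ _ (hσ _)
  let j₀ : M →+ (ι → MonoidAlgebra ℤ G) := AddMonoidHom.mk' (fun m => D (σ m)) fun m m' => by
    rw [hwd (σ (m + m')) (σ m * σ m') (by rw [hadd, hσ, hσ, hσ]), Subgroup.coe_mul,
      crossedHom_mul_of_mem_ker hD (σ m).2]
  have hsmul : ∀ (a : MonoidAlgebra ℤ G) (m : M), j₀ (a • m) = a • j₀ m := by
    intro a m
    have : j₀.comp ((AddMonoidHom.flip (smulAddHom (MonoidAlgebra ℤ G) M)) m) =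
        (AddMonoidHom.flip (smulAddHom (MonoidAlgebra ℤ G) _)) (j₀ m) := by
      refine addMonoidHom_ext_of fun g => ?_
      change D (σ (of ℤ G g • m)) = of ℤ G g • D (σ m)
      obtain ⟨f, rfl⟩ := hε g
      rw [← crossedHom_conj hD (σ m).2]
      have hm := (MonoidHom.normal_ker ε).conj_mem _ (σ m).2 f
      refine hwd _ ⟨_, hm⟩ ?_
      rw [hσ, hconj f (σ m) ⟨_, hm⟩ rfl, hσ]
    exact DFunLike.congr_fun this a
  let j : M →ₗ[MonoidAlgebra ℤ G] (ι → MonoidAlgebra ℤ G) :=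
    { toFun := j₀, map_add' := j₀.map_add, map_smul' := hsmul }
  have hj : ∀ r : ε.ker, j (π r) = D r := hσD
  refine ⟨j, ?_, le_antisymm ?_ ?_⟩
  · rw [injective_iff_map_eq_zero]
    intro m hm
    obtain ⟨r, rfl⟩ : ∃ r, π r = m := ⟨_, hσ m⟩
    rw [hj] at hm
    let E : FreeGroup ι → G → M := fun f g =>
      π ⟨s g * f * (s (g * ε f))⁻¹, by simp [MonoidHom.mem_ker, hs _]⟩
    have hE : ∀ f f' g, E (f * f') g = E f g + E f' (g * ε f) := by
      intro f f' g
      rw [← hadd]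
      refine congrArg π (Subtype.ext ?_)
      simp only [Subgroup.coe_mul, map_mul, mul_assoc, inv_mul_cancel_left]
    have h := coinduced_crossedHom_eq_zero hDof hD hE hm 1
    have hr : E r 1 = of ℤ G 1 • π r := by
      rw [← hs 1]
      refine hconj _ _ _ ?_
      simp only [hs 1, MonoidHom.mem_ker.1 r.2, mul_one]
    rwa [hr, of_one_smul] at h
  · rintro _ ⟨m, rfl⟩
    obtain ⟨r, rfl⟩ : ∃ r, π r = m := ⟨_, hσ m⟩
    rw [hj, LinearMap.mem_ker]
    have hT : ∀ f, Fintype.linearCombination (MonoidAlgebra ℤ G)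
        (fun i => of ℤ G (ε (FreeGroup.of i)) - 1) (D f) = of ℤ G (ε f) - 1 := by
      intro f
      induction f using FreeGroup.induction_on with
      | C1 => rw [crossedHom_one hD, map_zero, map_one, map_one, sub_self]
      | of i => rw [hDof, Fintype.linearCombination_apply_single, one_smul]
      | inv_of i ih =>
        rw [crossedHom_inv hD, map_neg, map_smul, ih, smul_eq_mul, mul_sub, mul_one, ← map_mul,
          ← map_mul, inv_mul_cancel, map_one, map_one, neg_sub]
      | mul f f' hf hf' =>
        rw [hD, map_add, map_smul, hf, hf', smul_eq_mul, mul_sub, mul_one, ← map_mul, ← map_mul]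
        abel
    rw [hT, MonoidHom.mem_ker.1 r.2, map_one, sub_self]
  · intro a ha
    exact mem_of_linearCombination_eq_zero hDof hD hε (LinearMap.range j)
      (fun r hr => ⟨π ⟨r, hr⟩, hj _⟩) ha

section Schanuel

variable {R M₁ M₂ P₁ P₂ Q : Type*} [Ring R] [AddCommGroup M₁] [Module R M₁] [AddCommGroup M₂]
  [Module R M₂] [AddCommGroup P₁] [Module R P₁] [AddCommGroup P₂] [Module R P₂] [AddCommGroup Q]
  [Module R Q]

theorem nonempty_prod_equiv_eqLocus {j₁ : M₁ →ₗ[R] P₁} (hj₁ : Function.Injective j₁)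
    {t₁ : P₁ →ₗ[R] Q} (h₁ : LinearMap.range j₁ = LinearMap.ker t₁) (t₂ : P₂ →ₗ[R] Q)
    (v : P₂ →ₗ[R] P₁) (hv : t₁ ∘ₗ v = t₂) :
    Nonempty ((M₁ × P₂) ≃ₗ[R]
      LinearMap.eqLocus (t₁ ∘ₗ LinearMap.fst R P₁ P₂) (t₂ ∘ₗ LinearMap.snd R P₁ P₂)) := by
  have hjt : ∀ m, t₁ (j₁ m) = 0 := fun m => by
    rw [← LinearMap.mem_ker, ← h₁]
    exact ⟨m, rfl⟩
  have hvt : ∀ p, t₁ (v p) = t₂ p := fun p => DFunLike.congr_fun hv p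
  let φ : (M₁ × P₂) →ₗ[R] P₁ × P₂ := (LinearMap.coprod j₁ v).prod (LinearMap.snd R M₁ P₂)
  have hφ : ∀ x, φ x = (j₁ x.1 + v x.2, x.2) := fun x => rfl
  have hmem : ∀ x, φ x ∈
      LinearMap.eqLocus (t₁ ∘ₗ LinearMap.fst R P₁ P₂) (t₂ ∘ₗ LinearMap.snd R P₁ P₂) := by
    intro x
    simp [LinearMap.mem_eqLocus, hφ, hjt, hvt]
  refine ⟨LinearEquiv.ofBijective (φ.codRestrict _ hmem) ⟨?_, ?_⟩⟩
  · rintro ⟨m, p⟩ ⟨m', p'⟩ h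
    have h' : (j₁ m + v p, p) = (j₁ m' + v p', p') := congrArg Subtype.val h
    obtain ⟨h1, rfl⟩ := Prod.mk.inj h'
    rw [hj₁ (add_right_cancel h1)]
  · rintro ⟨⟨p, q⟩, hpq⟩
    have hpq' : t₁ p = t₂ q := hpq
    have hk : p - v q ∈ LinearMap.range j₁ := by
      rw [h₁, LinearMap.mem_ker, map_sub, hvt, hpq', sub_self]
    obtain ⟨m, hm⟩ := hk
    refine ⟨(m, q), Subtype.ext ?_⟩
    rw [LinearMap.codRestrict_apply, hφ, hm, sub_add_cancel]

/-- **Schanuel's lemma**. -/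
theorem schanuel [Module.Projective R P₁] [Module.Projective R P₂]
    {j₁ : M₁ →ₗ[R] P₁} (hj₁ : Function.Injective j₁) {t₁ : P₁ →ₗ[R] Q}
    (h₁ : LinearMap.range j₁ = LinearMap.ker t₁)
    {j₂ : M₂ →ₗ[R] P₂} (hj₂ : Function.Injective j₂) {t₂ : P₂ →ₗ[R] Q}
    (h₂ : LinearMap.range j₂ = LinearMap.ker t₂)
    (ht : LinearMap.range t₁ = LinearMap.range t₂) :
    Nonempty ((M₁ × P₂) ≃ₗ[R] (M₂ × P₁)) := by
  obtain ⟨v, hv⟩ := Module.projective_lifting_property t₁.rangeRestrict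
    (t₂.codRestrict (LinearMap.range t₁) fun x => ht ▸ LinearMap.mem_range_self t₂ x)
    t₁.surjective_rangeRestrict
  obtain ⟨u, hu⟩ := Module.projective_lifting_property t₂.rangeRestrict
    (t₁.codRestrict (LinearMap.range t₂) fun x => ht ▸ LinearMap.mem_range_self t₁ x)
    t₂.surjective_rangeRestrict
  obtain ⟨e₁⟩ := nonempty_prod_equiv_eqLocus hj₁ h₁ t₂ v
    (LinearMap.ext fun x => congrArg Subtype.val (DFunLike.congr_fun hv x))
  obtain ⟨e₂⟩ := nonempty_prod_equiv_eqLocus hj₂ h₂ t₁ u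
    (LinearMap.ext fun x => congrArg Subtype.val (DFunLike.congr_fun hu x))
  refine ⟨e₁ ≪≫ₗ LinearEquiv.ofSubmodules (LinearEquiv.prodComm R P₁ P₂) _ _ ?_ ≪≫ₗ e₂.symm⟩
  ext ⟨p, q⟩
  simp [LinearMap.mem_eqLocus, eq_comm]

end Schanuel

end RelationModule

/-- for two free presentations `1 → R_i → F_i → G → 1` of a finite
group `G` (`F_i` free of rank `d_i`), one has
`R_1^{ab} ⊕ ℤ[G]^{(d_2)} ≅ R_2^{ab} ⊕ ℤ[G]^{(d_1)}` as `ℤ[G]`-modules.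

Each relation module `R_i^{ab}` is characterised as a `ℤ[G]`-module `M_i` together
with a surjective map `π_i : R_i → M_i` satisfying `π(rs) = π(r) + π(s)`, with
kernel exactly `[R_i, R_i]`, and compatible with conjugation:
`π(f r f⁻¹) = ε_i(f) • π(r)`. -/
theorem relationModules_stably_isomorphic (G : Type) [Group G] [Finite G]
    (d₁ d₂ : ℕ)
    (ε₁ : FreeGroup (Fin d₁) →* G) (hε₁ : Function.Surjective ε₁)
    (ε₂ : FreeGroup (Fin d₂) →* G) (hε₂ : Function.Surjective ε₂)
    (M₁ : Type) [AddCommGroup M₁] [Module (MonoidAlgebra ℤ G) M₁]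
    (π₁ : ε₁.ker → M₁)
    (hπ₁add : ∀ r s : ε₁.ker, π₁ (r * s) = π₁ r + π₁ s)
    (hπ₁surj : Function.Surjective π₁)
    (hπ₁ker : ∀ r : ε₁.ker, π₁ r = 0 ↔
      (r : FreeGroup (Fin d₁)) ∈ (⁅ε₁.ker, ε₁.ker⁆ : Subgroup (FreeGroup (Fin d₁))))
    (hπ₁conj : ∀ (f : FreeGroup (Fin d₁)) (r s : ε₁.ker),
      (s : FreeGroup (Fin d₁)) = f * r * f⁻¹ →
      π₁ s = MonoidAlgebra.of ℤ G (ε₁ f) • π₁ r)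
    (M₂ : Type) [AddCommGroup M₂] [Module (MonoidAlgebra ℤ G) M₂]
    (π₂ : ε₂.ker → M₂)
    (hπ₂add : ∀ r s : ε₂.ker, π₂ (r * s) = π₂ r + π₂ s)
    (hπ₂surj : Function.Surjective π₂)
    (hπ₂ker : ∀ r : ε₂.ker, π₂ r = 0 ↔
      (r : FreeGroup (Fin d₂)) ∈ (⁅ε₂.ker, ε₂.ker⁆ : Subgroup (FreeGroup (Fin d₂))))
    (hπ₂conj : ∀ (f : FreeGroup (Fin d₂)) (r s : ε₂.ker),
      (s : FreeGroup (Fin d₂)) = f * r * f⁻¹ →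
      π₂ s = MonoidAlgebra.of ℤ G (ε₂ f) • π₂ r) :
    Nonempty ((M₁ × (Fin d₂ → MonoidAlgebra ℤ G)) ≃ₗ[MonoidAlgebra ℤ G]
      (M₂ × (Fin d₁ → MonoidAlgebra ℤ G))) := by
  obtain ⟨j₁, hj₁, h₁⟩ :=
    RelationModule.exists_injective_range_eq_ker hε₁ hπ₁add hπ₁surj hπ₁ker hπ₁conj
  obtain ⟨j₂, hj₂, h₂⟩ :=
    RelationModule.exists_injective_range_eq_ker hε₂ hπ₂add hπ₂surj hπ₂ker hπ₂conj
  exact RelationModule.schanuel hj₁ h₁ hj₂ h₂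
    ((RelationModule.range_linearCombination hε₁).trans
      (RelationModule.range_linearCombination hε₂).symm)
end

section
/- Let n ≥ 3 be an odd integer, F a free group of finite rank, ε : F → D_n a surjective group homomorphism, and R = ker ε. Then the relation module R^{ab} is an invertible D_n-lattice: there exist a D_n-lattice M′ and a finite set X with a D_n-action such that R^{ab} ⊕ M′ is isomorphic as a ℤ[D_n]-module to the free ℤ-module on X with D_n permuting the basis X. -/
section

open MonoidAlgebra

/-- The Fox derivative of a free group with values in the free `ℤ[G]`-module on the generators. -/
theorem exists_foxDerivative {G ι : Type*} [Group G] [DecidableEq ι] (ε : FreeGroup ι →* G) :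
    ∃ D : FreeGroup ι → ι → MonoidAlgebra ℤ G,
      (∀ k, D (FreeGroup.of k) = Pi.single k 1) ∧
      ∀ x y, D (x * y) = D x + of ℤ G (ε x) • D y := by
  let ρ : FreeGroup ι →* Equiv.Perm (ι → MonoidAlgebra ℤ G) := FreeGroup.lift fun k ↦
    { toFun v := Pi.single k 1 + of ℤ G (ε (FreeGroup.of k)) • v
      invFun v := of ℤ G (ε (FreeGroup.of k))⁻¹ • (v - Pi.single k 1)
      left_inv v := by
        dsimp only
        rw [add_sub_cancel_left, smul_smul, ← map_mul, inv_mul_cancel, map_one, one_smul]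
      right_inv v := by
        dsimp only
        rw [smul_smul, ← map_mul, mul_inv_cancel, map_one, one_smul, add_sub_cancel] }
  have hρ (x : FreeGroup ι) : ∀ v, ρ x v = ρ x 0 + of ℤ G (ε x) • v := by
    induction x using FreeGroup.induction_on with
    | C1 =>
      intro v
      rw [map_one, map_one, map_one, one_smul, Equiv.Perm.one_apply, Equiv.Perm.one_apply, zero_add]
    | of k => simp [ρ]
    | inv_of k ih =>
      intro v
      have hk (w) : ρ (FreeGroup.of k)⁻¹ w
          = of ℤ G (ε (FreeGroup.of k))⁻¹ • (w - Pi.single k 1) := by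
        rw [map_inv, FreeGroup.lift_apply_of]
        rfl
      rw [hk, hk, map_inv ε, ← smul_add, zero_sub, neg_add_eq_sub]
    | mul x y hx hy =>
      intro v
      rw [map_mul, Equiv.Perm.mul_apply, Equiv.Perm.mul_apply, hy v, hx, hx (ρ y 0), map_mul,
        map_mul, mul_smul, smul_add, add_assoc]
  refine ⟨fun x ↦ ρ x 0, fun k ↦ by simp [ρ], fun x y ↦ ?_⟩
  dsimp only
  rw [map_mul, Equiv.Perm.mul_apply, hρ x]

/-- The boundary map of the Gruenberg resolution. -/
noncomputable def boundary {G ι : Type*} [Group G] [Fintype ι] (γ : ι → G) :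
    (ι → MonoidAlgebra ℤ G) →ₗ[MonoidAlgebra ℤ G] MonoidAlgebra ℤ G :=
  Fintype.linearCombination _ fun k ↦ of ℤ G (γ k) - 1

theorem boundary_single {G ι : Type*} [Group G] [Fintype ι] [DecidableEq ι] (γ : ι → G) (k : ι)
    (a : MonoidAlgebra ℤ G) : boundary γ (Pi.single k a) = a * (of ℤ G (γ k) - 1) := by
  simp [boundary]

section Fox

variable {G ι : Type*} [Group G] {ε : FreeGroup ι →* G} {D : FreeGroup ι → ι → MonoidAlgebra ℤ G}

theorem fox_one (hD : ∀ x y, D (x * y) = D x + of ℤ G (ε x) • D y) : D 1 = 0 := by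
  have := hD 1 1
  rwa [mul_one, map_one, map_one, one_smul, left_eq_add] at this

theorem fox_inv (hD : ∀ x y, D (x * y) = D x + of ℤ G (ε x) • D y) (x) :
    D x⁻¹ = - (of ℤ G (ε x)⁻¹ • D x) := by
  have := hD x⁻¹ x
  rw [inv_mul_cancel, fox_one hD, map_inv] at this
  exact eq_neg_of_add_eq_zero_left this.symm

theorem boundary_fox [Fintype ι] [DecidableEq ι]
    (hD : ∀ x y, D (x * y) = D x + of ℤ G (ε x) • D y)
    (hD1 : ∀ k, D (FreeGroup.of k) = Pi.single k 1)
    (x : FreeGroup ι) : boundary (fun k ↦ ε (FreeGroup.of k)) (D x) = of ℤ G (ε x) - 1 := by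
  induction x using FreeGroup.induction_on with
  | C1 => rw [fox_one hD, map_zero, map_one, map_one, sub_self]
  | of k => rw [hD1, boundary_single, one_mul]
  | inv_of k ih =>
    rw [fox_inv hD, map_neg, map_smul, ih, map_inv ε, smul_eq_mul, mul_sub,
      ← map_mul (of ℤ G), inv_mul_cancel, map_one, mul_one, neg_sub]
  | mul x y hx hy =>
    rw [hD, map_add, map_smul, hx, hy, smul_eq_mul, mul_sub, ← map_mul, ← map_mul, mul_one]
    abel

/-- The Magnus embedding: the relation module embeds in the free module on the generators as the
kernel of the boundary map. -/
theorem exists_magnus_embedding [Fintype ι] [DecidableEq ι]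
    (hD : ∀ x y, D (x * y) = D x + of ℤ G (ε x) • D y)
    (hε : Function.Surjective ε)
    (hD1 : ∀ k, D (FreeGroup.of k) = Pi.single k 1)
    {M : Type*} [AddCommGroup M] [Module (MonoidAlgebra ℤ G) M]
    (π : ε.ker → M)
    (hπadd : ∀ r s : ε.ker, π (r * s) = π r + π s)
    (hπsurj : Function.Surjective π)
    (hπker : ∀ r : ε.ker, π r = 0 ↔
      (r : FreeGroup ι) ∈ (⁅ε.ker, ε.ker⁆ : Subgroup (FreeGroup ι)))
    (hπconj : ∀ (f : FreeGroup ι) (r s : ε.ker),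
      (s : FreeGroup ι) = f * r * f⁻¹ → π s = of ℤ G (ε f) • π r) :
    ∃ i : M →+ (ι → MonoidAlgebra ℤ G), Function.Injective i ∧
      (∀ g v, i (of ℤ G g • v) = of ℤ G g • i v) ∧
      (∀ v, boundary (fun k ↦ ε (FreeGroup.of k)) (i v) = 0) ∧
      ∀ u, boundary (fun k ↦ ε (FreeGroup.of k)) u = 0 → ∃ v, i v = u := by
  have hDadd {r s : FreeGroup ι} (hr : ε r = 1) : D (r * s) = D r + D s := by
    rw [hD, hr, map_one, one_smul]
  have hDmul {x y z : FreeGroup ι} (h : ε z = ε x * ε y) :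
      D (x * y * z⁻¹) = D x + of ℤ G (ε x) • D y - D z := by
    rw [hD, hD, fox_inv hD, map_mul, h, smul_neg, smul_smul, ← map_mul, mul_inv_cancel, map_one,
      one_smul, sub_eq_add_neg]
  -- the derivation vanishes on `[R, R]`, hence descends to `M`
  have hDker (r : FreeGroup ι) (hr : r ∈ ⁅ε.ker, ε.ker⁆) : D r = 0 := by
    let H : Subgroup (FreeGroup ι) :=
      { carrier := {x | ε x = 1 ∧ D x = 0}
        one_mem' := ⟨map_one ε, fox_one hD⟩
        mul_mem' := fun {x y} hx hy ↦ ⟨by rw [map_mul, hx.1, hy.1, one_mul],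
          by rw [hD, hx.2, hy.2, smul_zero, add_zero]⟩
        inv_mem' := fun {x} hx ↦ ⟨by rw [map_inv, hx.1, inv_one],
          by rw [fox_inv hD, hx.2, smul_zero, neg_zero]⟩ }
    have hH : ⁅ε.ker, ε.ker⁆ ≤ H := Subgroup.commutator_le.2 fun x hx y hy ↦ by
      rw [MonoidHom.mem_ker] at hx hy
      refine ⟨by simp [commutatorElement_def, hx, hy], ?_⟩
      rw [commutatorElement_def, hDadd (by simp [hx, hy]), hDadd (by simp [hx, hy]), hDadd hx,
        fox_inv hD, fox_inv hD, hx, hy, inv_one, map_one, one_smul, one_smul]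
      abel
    exact (hH hr).2
  have hπ1 : π 1 = 0 := by simpa using hπadd 1 1
  have hπinv (r : ε.ker) : π r⁻¹ = - π r := by
    have := hπadd r⁻¹ r
    rw [inv_mul_cancel, hπ1] at this
    exact eq_neg_of_add_eq_zero_left this.symm
  have hDπ {r s : ε.ker} (h : π r = π s) : D r = D s := by
    have h0 : D ((r⁻¹ * s : ε.ker) : FreeGroup ι) = 0 :=
      hDker _ ((hπker _).1 (by rw [hπadd, hπinv, h, neg_add_cancel]))
    have := congrArg (fun x : ε.ker ↦ D x) (mul_inv_cancel_left r s)
    simpa only [Subgroup.coe_mul _ r, hDadd r.2, h0, add_zero] using this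
  choose s hs using hπsurj
  have hDs (r : ε.ker) : D (s (π r)) = D r := hDπ (hs _)
  let i : M →+ (ι → MonoidAlgebra ℤ G) := AddMonoidHom.mk' (fun v ↦ D (s v)) fun v w ↦ by
    rw [← hDadd (s v).2, ← Subgroup.coe_mul]
    exact hDπ (by rw [hπadd, hs, hs, hs])
  have hi (r : ε.ker) : i (π r) = D r := hDs r
  -- a one-sided inverse of `i`, from a set-theoretic section of `ε`
  choose t ht using hε
  classical
  let P (x : FreeGroup ι) : M := if h : x ∈ ε.ker then π ⟨x, h⟩ else 0
  have hP (r : ε.ker) : P r = π r := dif_pos r.2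
  have hPmul {x y : FreeGroup ι} (hx : ε x = 1) (hy : ε y = 1) : P (x * y) = P x + P y :=
    (hP (⟨x, hx⟩ * ⟨y, hy⟩)).trans <| by rw [hπadd, ← hP, ← hP]
  have hPinv {x : FreeGroup ι} (hx : ε x = 1) : P x⁻¹ = - P x :=
    (hP (⟨x, hx⟩⁻¹)).trans <| by rw [hπinv, ← hP]
  have hiP {x : FreeGroup ι} (hx : ε x = 1) : i (P x) = D x := by
    rw [hP ⟨x, hx⟩, hi]
  let q (k : ι) : MonoidAlgebra ℤ G →ₗ[ℤ] M :=
    Finsupp.linearCombination ℤ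
      (fun g ↦ P (t g * FreeGroup.of k * (t (g * ε (FreeGroup.of k)))⁻¹)) ∘ₗ
      (coeffLinearEquiv ℤ).toLinearMap
  have hq (k) (g : G) (a : ℤ) : q k (single g a) =
      a • P (t g * FreeGroup.of k * (t (g * ε (FreeGroup.of k)))⁻¹) := by simp [q]
  let ψ : (ι → MonoidAlgebra ℤ G) →+ M :=
    ∑ k, (q k).toAddMonoidHom.comp (Pi.evalAddMonoidHom _ k)
  have hψ (k) (a) : ψ (Pi.single k a) = q k a := by
    simp only [ψ, AddMonoidHom.finsetSum_apply]
    rw [Finset.sum_eq_single k]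
    · simp
    · intro b _ hb
      simp [Pi.single_eq_of_ne hb]
    · simp
  have hψD (x : FreeGroup ι) : ∀ g, ψ (of ℤ G g • D x) = P (t g * x * (t (g * ε x))⁻¹) := by
    induction x using FreeGroup.induction_on with
    | C1 =>
      intro g
      have : P 1 = 0 := by rw [← hπ1, ← hP, Subgroup.coe_one]
      simp [fox_one hD, this]
    | of k =>
      intro g
      rw [hD1, ← Pi.single_smul, smul_eq_mul, mul_one, hψ, of_apply, hq, one_smul]
    | inv_of k ih =>
      intro g
      rw [fox_inv hD, smul_neg, map_neg, smul_smul, ← map_mul, ih, ← hPinv]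
      · congr 1
        simp [mul_assoc]
      · simp [ht]
    | mul x y hx hy =>
      intro g
      rw [hD, smul_add, map_add, smul_smul, ← map_mul, hx, hy, ← hPmul]
      · congr 1
        simp [mul_assoc]
      · simp [ht]
      · simp [ht]
  have hψi (v : M) : ψ (i v) = v := by
    have h1 : ε (t 1) = 1 := ht 1
    have := hψD (s v) 1
    rw [map_one, one_smul, (s v).2, one_mul, hPmul, hPmul h1 (s v).2, hPinv h1, hP, hs,
      add_neg_cancel_comm] at this
    · exact this
    · rw [map_mul, h1, (s v).2, one_mul]
    · rw [map_inv, h1, inv_one]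
  let Θ : MonoidAlgebra ℤ G →ₗ[ℤ] (ι → MonoidAlgebra ℤ G) :=
    Finsupp.linearCombination ℤ (fun g ↦ D (t g)) ∘ₗ (coeffLinearEquiv ℤ).toLinearMap
  have hΘ (g : G) (a : ℤ) : Θ (single g a) = a • D (t g) := by simp [Θ]
  have hiψ (u) : i (ψ u) = u - Θ (boundary (fun k ↦ ε (FreeGroup.of k)) u) := by
    have key (k : ι) (a : MonoidAlgebra ℤ G) : i (ψ (Pi.single k a)) =
        Pi.single k a - Θ (boundary (fun k ↦ ε (FreeGroup.of k)) (Pi.single k a)) := by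
      rw [boundary_single, hψ]
      induction a using MonoidAlgebra.induction_linear with
      | zero => simp
      | add a b ha hb =>
        rw [map_add, map_add, ha, hb, Pi.single_add, add_mul, map_add]
        abel
      | single g a =>
        have h1 : (single g a : MonoidAlgebra ℤ G) = a • single g 1 := by simp
        have h2 : ε (t (g * ε (FreeGroup.of k))) = ε (t g) * ε (FreeGroup.of k) := by
          rw [ht, ht]
        rw [hq, map_zsmul, hiP, hDmul h2, ht, hD1, mul_sub, mul_one, of_apply, of_apply,
          single_mul_single, mul_one, map_sub, hΘ, hΘ, ← Pi.single_smul, smul_eq_mul, mul_one,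
          h1, Pi.single_smul]
        · module
        · simp [ht]
    conv_lhs => rw [← Finset.univ_sum_single u]
    conv_rhs => rw [← Finset.univ_sum_single u]
    simp only [map_sum, key, Finset.sum_sub_distrib]
  refine ⟨i, fun v w h ↦ by rw [← hψi v, h, hψi], fun g v ↦ ?_, fun v ↦ ?_, fun u hu ↦ ?_⟩
  · obtain ⟨r, rfl⟩ : ∃ r, π r = v := ⟨s v, hs v⟩
    have hm : ε (t g * r * (t g)⁻¹) = 1 := by simp [ht, MonoidHom.mem_ker.1 r.2]
    have hr : ε (t g) = ε (t g) * ε r := by rw [r.2, mul_one]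
    have hc := hπconj (t g) r ⟨_, hm⟩ rfl
    rw [ht] at hc
    rw [← hc, hi, hi, hDmul hr, ht, add_sub_cancel_left]
  · change boundary _ (D (s v)) = 0
    rw [boundary_fox hD hD1, (s v).2, map_one, sub_self]
  · exact ⟨ψ u, by rw [hiψ, hu, map_zero, sub_zero]⟩

end Fox

/-- A retract of a module has a complement. -/
theorem exists_complement_of_retract {A M P : Type*} [Ring A] [AddCommGroup M] [Module A M]
    [AddCommGroup P] [Module A P] (j : M →ₗ[A] P) (p : P →ₗ[A] M) (h : ∀ m, p (j m) = m) :
    ∃ S : Submodule A P, Nonempty ((M × S) ≃ₗ[A] P) := by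
  refine ⟨LinearMap.ker p, ⟨LinearEquiv.ofBijective (j.coprod (LinearMap.ker p).subtype) ⟨?_, ?_⟩⟩⟩
  · rw [injective_iff_map_eq_zero]
    rintro ⟨m, s, hs⟩ h0
    have hm : m = 0 := by simpa [h, LinearMap.mem_ker.1 hs] using congrArg p h0
    subst hm
    ext
    · rfl
    · simpa using h0
  · intro x
    exact ⟨(p x, ⟨x - j (p x), by simp [h]⟩), by simp⟩

/-- A module `M` over `ℤ[G]` is a direct summand of the permutation module on a finite `G`-set `X`
as soon as the identity of `M` decomposes equivariantly over `X`. -/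
theorem exists_complement_of_sum_smul {G M X : Type*} [Group G] [AddCommGroup M]
    [Module (MonoidAlgebra ℤ G) M] [Fintype X] [MulAction G X]
    (m : X → M) (hm : ∀ (g : G) x, m (g • x) = of ℤ G g • m x)
    (φ : X → M →+ ℤ) (hφ : ∀ (g : G) x v, φ (g • x) (of ℤ G g • v) = φ x v)
    (h : ∀ v, ∑ x, φ x v • m x = v) :
    ∃ S : Submodule (MonoidAlgebra ℤ G) (Representation.ofMulAction ℤ G X).asModule,
      Nonempty ((M × S) ≃ₗ[MonoidAlgebra ℤ G] (Representation.ofMulAction ℤ G X).asModule) := by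
  classical
  let ρ := Representation.ofMulAction ℤ G X
  let j₀ : M →ₗ[ℤ] ρ.asModule := AddMonoidHom.toIntLinearMap
    { toFun v := ρ.asModuleEquiv.symm (∑ x, φ x v • single x (1 : ℤ))
      map_zero' := by simp
      map_add' v w := by simp only [map_add, add_smul, Finset.sum_add_distrib] }
  let q : MonoidAlgebra ℤ X →ₗ[ℤ] M :=
    Finsupp.linearCombination ℤ m ∘ₗ (coeffLinearEquiv ℤ).toLinearMap
  let p₀ : ρ.asModule →ₗ[ℤ] M := AddMonoidHom.toIntLinearMap
    (q.toAddMonoidHom.comp ρ.asModuleEquiv.toAddEquiv.toAddMonoidHom)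
  have hj (v : M) : j₀ v = ρ.asModuleEquiv.symm (∑ x, φ x v • single x (1 : ℤ)) := rfl
  have hp (y) : p₀ (ρ.asModuleEquiv.symm y) = q y := rfl
  have hq (x) (a : ℤ) : q (single x a) = a • m x := by simp [q]
  refine exists_complement_of_retract (equivariantOfLinearOfComm j₀ ?_)
    (equivariantOfLinearOfComm p₀ ?_) ?_
  · intro g v
    have := Representation.asModuleEquiv_symm_map_rho ρ g (∑ x, φ x v • single x (1 : ℤ))
    rw [of_apply] at this
    rw [hj, hj, ← this]
    congr 1
    rw [map_sum, ← Equiv.sum_comp (MulAction.toPerm g)]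
    refine Finset.sum_congr rfl fun x _ ↦ ?_
    have := hφ g x v
    rw [of_apply] at this
    rw [MulAction.toPerm_apply, this, map_zsmul, Representation.ofMulAction_single]
  · intro g v
    obtain ⟨v, rfl⟩ := ρ.asModuleEquiv.symm.surjective v
    have := Representation.asModuleEquiv_symm_map_rho ρ g v
    rw [of_apply] at this
    rw [← this, hp, hp]
    clear this
    induction v using MonoidAlgebra.induction_linear with
    | zero => simp
    | add v w hv hw => simp only [map_add, smul_add, hv, hw]
    | single x a =>
      rw [Representation.ofMulAction_single, hq, hq, hm, of_apply, smul_comm]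
  · intro v
    simp only [equivariantOfLinearOfComm_apply, hj, hp, map_sum, map_zsmul, hq, one_smul, h]

theorem sum_coeff_smul_single {G : Type*} [Fintype G] (x : MonoidAlgebra ℤ G) :
    ∑ g, x.coeff g • (single g 1 : MonoidAlgebra ℤ G) = x := by
  conv_rhs => rw [← sum_coeff_single x, Finsupp.sum_fintype _ _ (by simp)]
  simp

/-- Schanuel's lemma for relation modules: a decomposition of the identity on the kernel of one
boundary map yields an invertibility statement for the kernel of any other boundary map whose
image is the same ideal. -/
theorem exists_complement_of_boundary {G ι κ M X : Type} [Group G] [Fintype G] [Fintype ι]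
    [DecidableEq ι] [Fintype κ] [DecidableEq κ] [AddCommGroup M] [Module (MonoidAlgebra ℤ G) M]
    [Fintype X] [MulAction G X] (γ : ι → G) (δ : κ → G)
    (hγ : ∀ k, ∃ u, boundary δ u = of ℤ G (γ k) - 1)
    (hδ : ∀ k, ∃ u, boundary γ u = of ℤ G (δ k) - 1)
    (i : M →+ (ι → MonoidAlgebra ℤ G)) (hi : Function.Injective i)
    (hismul : ∀ g v, i (of ℤ G g • v) = of ℤ G g • i v)
    (hi0 : ∀ v, boundary γ (i v) = 0)
    (hirange : ∀ u, boundary γ u = 0 → ∃ v, i v = u)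
    (m : X → κ → MonoidAlgebra ℤ G) (hm : ∀ (g : G) x, m (g • x) = of ℤ G g • m x)
    (hm0 : ∀ x, boundary δ (m x) = 0)
    (φ : X → (κ → MonoidAlgebra ℤ G) →+ ℤ)
    (hφ : ∀ (g : G) x v, boundary δ v = 0 → φ (g • x) (of ℤ G g • v) = φ x v)
    (hφm : ∀ v, boundary δ v = 0 → ∑ x, φ x v • m x = v) :
    ∃ (Y : Type) (_ : Fintype Y) (_ : MulAction G Y)
      (S : Submodule (MonoidAlgebra ℤ G) (Representation.ofMulAction ℤ G Y).asModule),
      Nonempty ((M × S) ≃ₗ[MonoidAlgebra ℤ G] (Representation.ofMulAction ℤ G Y).asModule) := by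
  classical
  choose a ha using hγ
  choose b hb using hδ
  let L : (ι → MonoidAlgebra ℤ G) →ₗ[MonoidAlgebra ℤ G] (κ → MonoidAlgebra ℤ G) :=
    Fintype.linearCombination _ a
  let K : (κ → MonoidAlgebra ℤ G) →ₗ[MonoidAlgebra ℤ G] (ι → MonoidAlgebra ℤ G) :=
    Fintype.linearCombination _ b
  have hL (u) : boundary δ (L u) = boundary γ u := by
    simp only [L, boundary, Fintype.linearCombination_apply, map_sum, map_smul] at ha ⊢
    simp only [ha]
  have hK (u) : boundary γ (K u) = boundary δ u := by
    simp only [K, boundary, Fintype.linearCombination_apply, map_sum, map_smul] at hb ⊢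
    simp only [hb]
  have hmK (x) : ∃ v, i v = K (m x) := hirange _ (by rw [hK, hm0])
  have heK (k : ι) (g : G) : ∃ v, i v =
      Pi.single k (single g 1) - K (L (Pi.single k (single g 1))) :=
    hirange _ (by rw [map_sub, hK, hL, sub_self])
  choose p hp using hmK
  choose q hq using heK
  refine ⟨X ⊕ (Σ _ : ι, G), inferInstance, inferInstance, exists_complement_of_sum_smul
    (Sum.elim p fun y ↦ q y.1 y.2) ?_
    (Sum.elim (fun x ↦ (φ x).comp (L.toAddMonoidHom.comp i)) fun y ↦
      (Finsupp.applyAddHom y.2).comp ((coeffAddEquiv (R := ℤ) (M := G)).toAddMonoidHom.comp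
        ((Pi.evalAddMonoidHom _ y.1).comp i))) ?_ ?_⟩
  · rintro g (x | ⟨k, h⟩)
    · apply hi
      change i (p (g • x)) = i (of ℤ G g • p x)
      rw [hismul, hp, hp, hm, map_smul]
    · apply hi
      have h1 : (single (g * h) 1 : MonoidAlgebra ℤ G) = of ℤ G g • single h 1 := by
        simp [single_mul_single]
      change i (q k (g * h)) = i (of ℤ G g • q k h)
      rw [hismul, hq, hq, h1, Pi.single_smul, map_smul, map_smul, smul_sub]
  · rintro g (x | ⟨k, h⟩) v
    · change φ (g • x) (L (i (of ℤ G g • v))) = φ x (L (i v))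
      rw [hismul, map_smul, hφ _ _ _ (by rw [hL, hi0])]
    · change (i (of ℤ G g • v) k).coeff (g * h) = (i v k).coeff h
      rw [hismul, Pi.smul_apply, smul_eq_mul, of_apply, coeff_single_mul_apply,
        inv_mul_cancel_left, one_mul]
  · intro v
    apply hi
    rw [Fintype.sum_sum_type, Fintype.sum_sigma, map_add, map_sum, map_sum]
    have h1 : ∑ x, φ x (L (i v)) • K (m x) = K (L (i v)) := by
      conv_rhs => rw [← hφm (L (i v)) (by rw [hL, hi0])]
      rw [map_sum]
      simp only [map_zsmul]
    have h2 : ∑ k, ∑ g, (i v k).coeff g • (Pi.single k (single g 1) : ι → MonoidAlgebra ℤ G)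
        = i v := by
      conv_rhs => rw [← Finset.univ_sum_single (i v)]
      refine Finset.sum_congr rfl fun k _ ↦ ?_
      conv_rhs => rw [← sum_coeff_smul_single (i v k)]
      rw [← AddMonoidHom.single_apply, map_sum]
      simp only [map_zsmul, AddMonoidHom.single_apply]
    have h4 : K (L (i v)) = ∑ k, ∑ g, (i v k).coeff g • K (L (Pi.single k (single g 1))) := by
      conv_lhs => rw [← h2]
      simp only [map_sum, map_zsmul]
    have h3 : ∑ k, ∑ g, (i v k).coeff g • i (q k g) = i v - K (L (i v)) := by
      simp only [hq, smul_sub, Finset.sum_sub_distrib, h2]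
      rw [h4]
    simp only [map_sum, map_zsmul]
    change ∑ x, φ x (L (i v)) • i (p x) + ∑ k, ∑ g, (i v k).coeff g • i (q k g) = i v
    rw [h3]
    simp only [hp, h1, add_sub_cancel]

/-- The `D_n`-set of cosets of the subgroup generated by the reflection `sr e`. -/
def ReflCoset (n : ℕ) (_ : ZMod n) : Type := ZMod n

/-- The `D_n`-set of cosets of the rotation subgroup. -/
def OrientCoset (_ : ℕ) : Type := Bool

namespace DihedralGroup

variable {n : ℕ}

instance [NeZero n] (e : ZMod n) : Fintype (ReflCoset n e) := inferInstanceAs (Fintype (ZMod n))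

instance : Fintype (OrientCoset n) := inferInstanceAs (Fintype Bool)

instance (e : ZMod n) : MulAction (DihedralGroup n) (ReflCoset n e) where
  smul g (i : ZMod n) := match g with
    | r k => k + i
    | sr k => e - k - i
  one_smul (i : ZMod n) := zero_add i
  mul_smul g h (i : ZMod n) := by
    rcases g with k | k <;> rcases h with l | l
    · exact add_assoc k l i
    · change e - (l - k) - i = k + (e - l - i)
      ring
    · change e - (k + l) - i = e - k - (l + i)
      ring
    · change l - k + i = e - k - (e - l - i)
      ring

instance : MulAction (DihedralGroup n) (OrientCoset n) where
  smul g (b : Bool) := match g with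
    | r _ => b
    | sr _ => !b
  one_smul _ := rfl
  mul_smul g h (b : Bool) := by
    rcases g with k | k <;> rcases h with l | l
    · rfl
    · rfl
    · rfl
    · exact (Bool.not_not b).symm

theorem exists_boundary_eq [NeZero n] (g : DihedralGroup n) :
    ∃ u, boundary ![sr 0, sr 1] u = of ℤ (DihedralGroup n) g - 1 := by
  have hmul {g h : DihedralGroup n} (hg : ∃ u, boundary ![sr 0, sr 1] u = of ℤ _ g - 1)
      (hh : ∃ u, boundary ![sr 0, sr 1] u = of ℤ _ h - 1) :
      ∃ u, boundary ![sr 0, sr 1] u = of ℤ _ (g * h) - 1 := by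
    obtain ⟨u, hu⟩ := hg
    obtain ⟨w, hw⟩ := hh
    refine ⟨u + of ℤ _ g • w, ?_⟩
    rw [map_add, map_smul, hu, hw, map_mul, smul_eq_mul]
    noncomm_ring
  have h0 : ∃ u, boundary ![sr 0, sr 1] u = of ℤ (DihedralGroup n) (sr 0) - 1 :=
    ⟨Pi.single 0 1, by rw [boundary_single, one_mul]; rfl⟩
  have h1 : ∃ u, boundary ![sr 0, sr 1] u = of ℤ (DihedralGroup n) (sr 1) - 1 :=
    ⟨Pi.single 1 1, by rw [boundary_single, one_mul]; rfl⟩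
  have hr (k : ℕ) : ∃ u, boundary ![sr 0, sr 1] u = of ℤ (DihedralGroup n) (r 1 ^ k) - 1 := by
    induction k with
    | zero => exact ⟨0, by rw [pow_zero, map_one, sub_self, map_zero]⟩
    | succ k ih =>
      rw [pow_succ, ← sub_zero (1 : ZMod n), ← sr_mul_sr, sub_zero]
      rw [← sub_zero (1 : ZMod n), ← sr_mul_sr, sub_zero] at ih
      exact hmul ih (hmul h0 h1)
  have hr' (k : ZMod n) : ∃ u, boundary ![sr 0, sr 1] u = of ℤ (DihedralGroup n) (r k) - 1 := by
    have := hr k.val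
    rwa [r_one_pow, ZMod.natCast_zmod_val] at this
  rcases g with k | k
  · exact hr' k
  · have := hmul h0 (hr' k)
    rwa [sr_mul_r, zero_add] at this

section Decomposition

variable [NeZero n]

/-- Norm elements in the kernel of the boundary map of the reflections `sr 0` and `sr 1`. -/
noncomputable def relator : ReflCoset n 0 ⊕ ReflCoset n 1 ⊕ OrientCoset n →
    Fin 2 → MonoidAlgebra ℤ (DihedralGroup n)
  | .inl (i : ZMod n) => ![single (r i) 1 + single (sr (-i)) 1, 0]
  | .inr (.inl (i : ZMod n)) => ![0, single (r i) 1 + single (sr (1 - i)) 1]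
  | .inr (.inr false) => ![∑ j, single (r j) 1, ∑ j, single (sr j) 1]
  | .inr (.inr true) => ![∑ j, single (sr j) 1, ∑ j, single (r j) 1]

theorem sum_r_mul (k : ZMod n) :
    single (r k) (1 : ℤ) * ∑ j, single (r j) 1 = ∑ j, single (r j) 1 := by
  simp only [Finset.mul_sum, single_mul_single, r_mul_r, mul_one]
  exact Equiv.sum_comp (Equiv.addLeft k) fun j ↦ single (r j) (1 : ℤ)

theorem sum_sr_mul (k : ZMod n) :
    single (r k) (1 : ℤ) * ∑ j, single (sr j) 1 = ∑ j, single (sr j) 1 := by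
  simp only [Finset.mul_sum, single_mul_single, r_mul_sr, mul_one]
  exact (Equiv.subRight k).sum_comp fun j ↦ single (sr j) (1 : ℤ)

theorem sr_mul_sum_r (k : ZMod n) :
    single (sr k) (1 : ℤ) * ∑ j, single (r j) 1 = ∑ j, single (sr j) 1 := by
  simp only [Finset.mul_sum, single_mul_single, sr_mul_r, mul_one]
  exact Equiv.sum_comp (Equiv.addLeft k) fun j ↦ single (sr j) (1 : ℤ)

theorem sr_mul_sum_sr (k : ZMod n) :
    single (sr k) (1 : ℤ) * ∑ j, single (sr j) 1 = ∑ j, single (r j) 1 := by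
  simp only [Finset.mul_sum, single_mul_single, sr_mul_sr, mul_one]
  exact (Equiv.subRight k).sum_comp fun j ↦ single (r j) (1 : ℤ)

theorem sum_r_mul_sr (k : ZMod n) :
    (∑ j, single (r j) (1 : ℤ)) * single (sr k) 1 = ∑ j, single (sr j) 1 := by
  simp only [Finset.sum_mul, single_mul_single, r_mul_sr, mul_one]
  exact (Equiv.subLeft k).sum_comp fun j ↦ single (sr j) (1 : ℤ)

theorem sum_sr_mul_sr (k : ZMod n) :
    (∑ j, single (sr j) (1 : ℤ)) * single (sr k) 1 = ∑ j, single (r j) 1 := by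
  simp only [Finset.sum_mul, single_mul_single, sr_mul_sr, mul_one]
  exact (Equiv.subLeft k).sum_comp fun j ↦ single (r j) (1 : ℤ)

theorem relator_smul (g : DihedralGroup n) (x : ReflCoset n 0 ⊕ ReflCoset n 1 ⊕ OrientCoset n) :
    relator (g • x) = of ℤ (DihedralGroup n) g • relator x := by
  rcases x with (i : ZMod n) | (i : ZMod n) | b
  · rcases g with k | k
    · change ![single (r (k + i)) 1 + single (sr (-(k + i))) 1, 0] =
        single (r k) (1 : ℤ) • ![single (r i) 1 + single (sr (-i)) 1, 0]
      simp [mul_add, single_mul_single, sub_eq_add_neg, add_comm]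
    · change ![single (r (0 - k - i)) 1 + single (sr (-(0 - k - i))) 1, 0] =
        single (sr k) (1 : ℤ) • ![single (r i) 1 + single (sr (-i)) 1, 0]
      simp [mul_add, single_mul_single, sub_eq_add_neg, add_comm]
  · rcases g with k | k
    · change ![0, single (r (k + i)) 1 + single (sr (1 - (k + i))) 1] =
        single (r k) (1 : ℤ) • ![0, single (r i) 1 + single (sr (1 - i)) 1]
      simp [mul_add, single_mul_single, sub_add_eq_sub_sub_swap]
    · change ![0, single (r (1 - k - i)) 1 + single (sr (1 - (1 - k - i))) 1] =
        single (sr k) (1 : ℤ) • ![0, single (r i) 1 + single (sr (1 - i)) 1]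
      have h1 : 1 - (1 - k - i) = k + i := by ring
      have h2 : 1 - i - k = 1 - k - i := by ring
      simp [mul_add, single_mul_single, h1, h2, add_comm]
  · rcases g with k | k <;> cases b
    · change relator (.inr (.inr false)) = single (r k) (1 : ℤ) • relator (.inr (.inr false))
      simp [relator, sum_r_mul, sum_sr_mul]
    · change relator (.inr (.inr true)) = single (r k) (1 : ℤ) • relator (.inr (.inr true))
      simp [relator, sum_r_mul, sum_sr_mul]
    · change relator (.inr (.inr true)) = single (sr k) (1 : ℤ) • relator (.inr (.inr false))
      simp [relator, sr_mul_sum_r, sr_mul_sum_sr]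
    · change relator (.inr (.inr false)) = single (sr k) (1 : ℤ) • relator (.inr (.inr true))
      simp [relator, sr_mul_sum_r, sr_mul_sum_sr]

theorem boundary_relator (x : ReflCoset n 0 ⊕ ReflCoset n 1 ⊕ OrientCoset n) :
    boundary ![sr 0, sr 1] (relator x) = 0 := by
  rcases x with (i : ZMod n) | (i : ZMod n) | (b | b) <;>
  simp [boundary, Fintype.linearCombination_apply, relator, mul_sub, add_mul, single_mul_single,
    sum_r_mul_sr, sum_sr_mul_sr] <;> abel

theorem coeff_relation {v : Fin 2 → MonoidAlgebra ℤ (DihedralGroup n)}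
    (hv : boundary ![sr 0, sr 1] v = 0) (g : DihedralGroup n) :
    (v 0).coeff (g * sr 0) + (v 1).coeff (g * sr 1) - ((v 0).coeff g + (v 1).coeff g) = 0 := by
  have h := congrArg (fun x : MonoidAlgebra ℤ (DihedralGroup n) ↦ x.coeff g) hv
  simpa [boundary, Fintype.linearCombination_apply, mul_sub, coeff_mul_single_apply] using h

/-- The defect of `v` from being supported on the norm elements of `sr 0` and `sr 1`. -/
def defect (v : Fin 2 → MonoidAlgebra ℤ (DihedralGroup n)) : ℤ :=
  (v 0).coeff (r 0) - (v 0).coeff (sr 0)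

theorem coeff_sub_eq_defect {v : Fin 2 → MonoidAlgebra ℤ (DihedralGroup n)}
    (hv : boundary ![sr 0, sr 1] v = 0) (i : ZMod n) :
    (v 0).coeff (r i) - (v 0).coeff (sr (-i)) = defect v := by
  have h (i : ℕ) : (v 0).coeff (r i) - (v 0).coeff (sr (-i)) = defect v := by
    induction i with
    | zero => simp [defect]
    | succ i ih =>
      have h1 := coeff_relation hv (r (i + 1))
      have h2 := coeff_relation hv (sr (-i))
      rw [r_mul_sr, r_mul_sr, zero_sub, sub_add_cancel_right] at h1
      rw [sr_mul_sr, sr_mul_sr, zero_sub, neg_neg, sub_neg_eq_add, add_comm 1] at h2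
      push_cast
      linarith
  have := h i.val
  rwa [ZMod.natCast_zmod_val] at this

theorem coeff_sub_eq_defect' {v : Fin 2 → MonoidAlgebra ℤ (DihedralGroup n)}
    (hv : boundary ![sr 0, sr 1] v = 0) (i : ZMod n) :
    (v 1).coeff (sr (1 - i)) - (v 1).coeff (r i) = defect v := by
  have h1 := coeff_relation hv (r i)
  rw [r_mul_sr, r_mul_sr, zero_sub] at h1
  linarith [coeff_sub_eq_defect hv i]

theorem defect_r_smul {v : Fin 2 → MonoidAlgebra ℤ (DihedralGroup n)}
    (hv : boundary ![sr 0, sr 1] v = 0) (k : ZMod n) :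
    defect (of ℤ (DihedralGroup n) (r k) • v) = defect v := by
  rw [← coeff_sub_eq_defect hv (-k), defect]
  simp [coeff_single_mul_apply, -r_zero]

theorem defect_sr_smul {v : Fin 2 → MonoidAlgebra ℤ (DihedralGroup n)}
    (hv : boundary ![sr 0, sr 1] v = 0) (k : ZMod n) :
    defect (of ℤ (DihedralGroup n) (sr k) • v) = - defect v := by
  rw [← coeff_sub_eq_defect hv (-k), defect]
  simp [coeff_single_mul_apply, -r_zero]

/-- A defect-corrected count of the rotations in the first coordinate. -/
def rotationCount (v : Fin 2 → MonoidAlgebra ℤ (DihedralGroup n)) : ℤ :=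
  ∑ j, (v 0).coeff (r j) - (n / 2 : ℕ) * defect v

theorem rotationCount_r_smul {v : Fin 2 → MonoidAlgebra ℤ (DihedralGroup n)}
    (hv : boundary ![sr 0, sr 1] v = 0) (k : ZMod n) :
    rotationCount (of ℤ (DihedralGroup n) (r k) • v) = rotationCount v := by
  rw [rotationCount, rotationCount, defect_r_smul hv]
  simpa [coeff_single_mul_apply] using
    Equiv.sum_comp (Equiv.addLeft (-k)) fun j ↦ (v 0).coeff (r j)

theorem rotationCount_sr_smul (hn : Odd n) {v : Fin 2 → MonoidAlgebra ℤ (DihedralGroup n)}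
    (hv : boundary ![sr 0, sr 1] v = 0) (k : ZMod n) :
    rotationCount (of ℤ (DihedralGroup n) (sr k) • v) = rotationCount v - defect v := by
  have h1 : ∑ j, (v 0).coeff (sr (k + j)) = ∑ j, (v 0).coeff (sr (-j)) := by
    rw [← Equiv.sum_comp ((Equiv.addLeft k).trans (Equiv.neg _))]
    simp
  have h2 : ∑ j, (v 0).coeff (r j) - ∑ j, (v 0).coeff (sr (-j)) = n * defect v := by
    rw [← Finset.sum_sub_distrib]
    simp [coeff_sub_eq_defect hv]
  have h3 : (n : ℤ) = 2 * (n / 2 : ℕ) + 1 := by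
    exact_mod_cast (Nat.two_mul_div_two_add_one_of_odd hn).symm
  rw [rotationCount, rotationCount, defect_sr_smul hv]
  have h4 : ∑ j, ((of ℤ (DihedralGroup n) (sr k) • v) 0).coeff (r j) =
      ∑ j, (v 0).coeff (sr (k + j)) := by
    simp [coeff_single_mul_apply]
  rw [h4, h1]
  linear_combination -h2 - defect v * h3

/-- Coordinates dual to `relator` on the kernel of the boundary map. -/
def coord : ReflCoset n 0 ⊕ ReflCoset n 1 ⊕ OrientCoset n →
    (Fin 2 → MonoidAlgebra ℤ (DihedralGroup n)) → ℤ
  | .inl (i : ZMod n), v => (v 0).coeff (r i) - defect v + rotationCount v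
  | .inr (.inl (i : ZMod n)), v => (v 1).coeff (r i) + rotationCount v
  | .inr (.inr false), v => defect v - rotationCount v
  | .inr (.inr true), v => - rotationCount v

theorem defect_add (v w : Fin 2 → MonoidAlgebra ℤ (DihedralGroup n)) :
    defect (v + w) = defect v + defect w := by
  simp [defect]
  ring

theorem coord_add (x : ReflCoset n 0 ⊕ ReflCoset n 1 ⊕ OrientCoset n)
    (v w : Fin 2 → MonoidAlgebra ℤ (DihedralGroup n)) :
    coord x (v + w) = coord x v + coord x w := by
  rcases x with (i : ZMod n) | (i : ZMod n) | (b | b) <;>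
  simp [coord, rotationCount, defect_add, Finset.sum_add_distrib] <;> ring

theorem coord_smul (hn : Odd n) (g : DihedralGroup n)
    (x : ReflCoset n 0 ⊕ ReflCoset n 1 ⊕ OrientCoset n)
    {v : Fin 2 → MonoidAlgebra ℤ (DihedralGroup n)} (hv : boundary ![sr 0, sr 1] v = 0) :
    coord (g • x) (of ℤ (DihedralGroup n) g • v) = coord x v := by
  rcases g with k | k
  · have hd := defect_r_smul hv k
    have hc := rotationCount_r_smul hv k
    rcases x with (i : ZMod n) | (i : ZMod n) | (b | b)
    · change ((of ℤ (DihedralGroup n) (r k) • v) 0).coeff (r (k + i)) - defect _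
        + rotationCount _ = (v 0).coeff (r i) - _ + _
      rw [hd, hc]
      simp [coeff_single_mul_apply]
    · change ((of ℤ (DihedralGroup n) (r k) • v) 1).coeff (r (k + i))
        + rotationCount _ = (v 1).coeff (r i) + _
      rw [hc]
      simp [coeff_single_mul_apply]
    · change defect _ - rotationCount _ = defect v - rotationCount v
      rw [hd, hc]
    · change - rotationCount _ = - rotationCount v
      rw [hc]
  · have hd := defect_sr_smul hv k
    have hc := rotationCount_sr_smul hn hv k
    rcases x with (i : ZMod n) | (i : ZMod n) | (b | b)
    · change ((of ℤ (DihedralGroup n) (sr k) • v) 0).coeff (r (0 - k - i)) - defect _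
        + rotationCount _ = (v 0).coeff (r i) - defect v + rotationCount v
      rw [hd, hc]
      have : ((of ℤ (DihedralGroup n) (sr k) • v) 0).coeff (r (0 - k - i)) =
          (v 0).coeff (sr (-i)) := by
        have h : k + (0 - k - i) = -i := by ring
        rw [Pi.smul_apply, smul_eq_mul, of_apply, coeff_single_mul_apply, inv_sr, sr_mul_r, h,
          one_mul]
      linarith [coeff_sub_eq_defect hv i]
    · change ((of ℤ (DihedralGroup n) (sr k) • v) 1).coeff (r (1 - k - i))
        + rotationCount _ = (v 1).coeff (r i) + rotationCount v
      have : ((of ℤ (DihedralGroup n) (sr k) • v) 1).coeff (r (1 - k - i)) =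
          (v 1).coeff (sr (1 - i)) := by
        have h : k + (1 - k - i) = 1 - i := by ring
        simp [coeff_single_mul_apply, h]
      linarith [coeff_sub_eq_defect' hv i]
    · change - rotationCount _ = defect v - rotationCount v
      rw [hc, neg_sub]
    · change defect _ - rotationCount _ = - rotationCount v
      rw [hd, hc]
      ring

theorem sum_eq_sum_add_sum (x : MonoidAlgebra ℤ (DihedralGroup n)) (e : ZMod n) :
    ∑ i, (x.coeff (r i) • single (r i) 1 + x.coeff (sr (e - i)) • single (sr (e - i)) 1) = x := by
  ext g
  rcases g with k | k
  · simp [coeff_sum, Finsupp.single_apply]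
  · have h (i : ZMod n) : e - i = k ↔ i = e - k := by
      constructor <;> rintro rfl <;> ring
    simp [coeff_sum, Finsupp.single_apply, h]

theorem sum_coord_smul_relator {v : Fin 2 → MonoidAlgebra ℤ (DihedralGroup n)}
    (hv : boundary ![sr 0, sr 1] v = 0) : ∑ x, coord x v • relator x = v := by
  rw [Fintype.sum_sum_type, Fintype.sum_sum_type]
  change ∑ i : ZMod n, ((v 0).coeff (r i) - defect v + rotationCount v) •
      ![single (r i) 1 + single (sr (-i)) (1 : ℤ), 0] +
    (∑ i : ZMod n, ((v 1).coeff (r i) + rotationCount v) •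
      ![0, single (r i) 1 + single (sr (1 - i)) (1 : ℤ)] +
    ∑ b : Bool, coord (.inr (.inr b)) v • relator (.inr (.inr b))) = v
  rw [Fintype.sum_bool]
  simp only [coord, relator]
  ext1 l
  fin_cases l
  · have h (i : ZMod n) : (v 0).coeff (sr (-i)) = (v 0).coeff (r i) - defect v := by
      rw [← coeff_sub_eq_defect hv i, sub_sub_cancel]
    have hs : ∑ j, single (sr j) (1 : ℤ) = ∑ i : ZMod n, single (sr (-i)) 1 :=
      (Equiv.sum_comp (Equiv.neg _) fun j ↦ single (sr j) (1 : ℤ)).symm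
    have hv' := sum_eq_sum_add_sum (v 0) 0
    simp only [zero_sub, h] at hv'
    conv_rhs => change v 0; rw [← hv']
    simp only [Fin.zero_eta, Pi.add_apply, Finset.sum_apply, Pi.smul_apply,
      Matrix.cons_val_zero, smul_zero, Finset.sum_const_zero, zero_add, hs,
      Finset.smul_sum, ← Finset.sum_add_distrib]
    exact Finset.sum_congr rfl fun i _ ↦ by module
  · have h (i : ZMod n) : (v 1).coeff (sr (1 - i)) = (v 1).coeff (r i) + defect v := by
      rw [← coeff_sub_eq_defect' hv i, add_sub_cancel]
    have hs : ∑ j, single (sr j) (1 : ℤ) = ∑ i : ZMod n, single (sr (1 - i)) 1 :=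
      (Equiv.sum_comp (Equiv.subLeft 1) fun j ↦ single (sr j) (1 : ℤ)).symm
    have hv' := sum_eq_sum_add_sum (v 1) 1
    simp only [h] at hv'
    conv_rhs => change v 1; rw [← hv']
    simp only [Fin.mk_one, Pi.add_apply, Finset.sum_apply, Pi.smul_apply,
      Matrix.cons_val_zero, Matrix.cons_val_one, smul_zero, Finset.sum_const_zero, zero_add, hs,
      Finset.smul_sum, ← Finset.sum_add_distrib]
    exact Finset.sum_congr rfl fun i _ ↦ by module

end Decomposition

end DihedralGroup

end

/-- for odd `n ≥ 3` and any free presentation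
`1 → R → F → D_n → 1` (`F` free of finite rank `d`), the relation module
`R^{ab}` is an invertible `D_n`-lattice: there exist a finite `D_n`-set `X` and a
complementary lattice `M'` (realised as a `ℤ[D_n]`-submodule of the permutation
module) such that `R^{ab} ⊕ M'` is isomorphic as a `ℤ[D_n]`-module to the free
`ℤ`-module on `X` with `D_n` permuting the basis `X` (the module associated to
the permutation representation `Representation.ofMulAction ℤ (D_n) X`).

The relation module `R^{ab}` is characterised as a `ℤ[D_n]`-module `M` together
with a surjective map `π : R → M` satisfying `π(rs) = π(r) + π(s)`, with kernel
exactly `[R, R]`, and compatible with conjugation: `π(f r f⁻¹) = ε(f) • π(r)`. -/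
theorem relationModule_invertible (n : ℕ) (hn : 3 ≤ n) (hodd : Odd n) [NeZero n]
    (d : ℕ) (ε : FreeGroup (Fin d) →* DihedralGroup n) (hε : Function.Surjective ε)
    (M : Type) [AddCommGroup M] [Module (MonoidAlgebra ℤ (DihedralGroup n)) M]
    (π : ε.ker → M)
    (hπadd : ∀ r s : ε.ker, π (r * s) = π r + π s)
    (hπsurj : Function.Surjective π)
    (hπker : ∀ r : ε.ker, π r = 0 ↔
      (r : FreeGroup (Fin d)) ∈ (⁅ε.ker, ε.ker⁆ : Subgroup (FreeGroup (Fin d))))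
    (hπconj : ∀ (f : FreeGroup (Fin d)) (r s : ε.ker),
      (s : FreeGroup (Fin d)) = f * r * f⁻¹ →
      π s = MonoidAlgebra.of ℤ (DihedralGroup n) (ε f) • π r) :
    ∃ (X : Type) (_ : Fintype X) (m : MulAction (DihedralGroup n) X)
      (S : Submodule (MonoidAlgebra ℤ (DihedralGroup n))
        (@Representation.ofMulAction ℤ _ (DihedralGroup n) _ X m).asModule),
      Nonempty ((M × ↥S) ≃ₗ[MonoidAlgebra ℤ (DihedralGroup n)]
        (@Representation.ofMulAction ℤ _ (DihedralGroup n) _ X m).asModule) := by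
  classical
  obtain ⟨D, hD1, hD⟩ := exists_foxDerivative ε
  obtain ⟨i, hi, hismul, hi0, hirange⟩ :=
    exists_magnus_embedding hD hε hD1 π hπadd hπsurj hπker hπconj
  have hδ (k : Fin 2) : ∃ u, boundary (fun k ↦ ε (FreeGroup.of k)) u =
      MonoidAlgebra.of ℤ (DihedralGroup n) (![.sr 0, .sr 1] k) - 1 := by
    obtain ⟨x, hx⟩ := hε (![.sr 0, .sr 1] k)
    exact ⟨D x, by rw [boundary_fox hD hD1, hx]⟩
  exact exists_complement_of_boundary _ ![.sr 0, .sr 1]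
    (fun k ↦ DihedralGroup.exists_boundary_eq _) hδ i hi hismul hi0 hirange
    DihedralGroup.relator DihedralGroup.relator_smul DihedralGroup.boundary_relator
    (fun x ↦ AddMonoidHom.mk' (DihedralGroup.coord x) (DihedralGroup.coord_add x))
    (fun g x _ hv ↦ DihedralGroup.coord_smul hodd g x hv)
    fun _ hv ↦ DihedralGroup.sum_coord_smul_relator hv
end

section
/- Let n ≥ 3 be an odd integer, and let K/k be a finite Galois field extension with Galois group Gal(K/k) isomorphic to D_n via generators σ, τ. Let D_n act on the rational function field K(A, B_0, …, B_{n−1}, C_0, …, C_{n−1}) in 2n+1 variables over K by field automorphisms that act on K via the Galois identification and on the variables by: σ(A) = A, σ(B_i) = B_{i+1}, σ(C_i) = C_{i+1}; τ(A) = A^{-1}B_0B_1⋯B_{n−1}, τ(B_0) = B_1C_0C_1^{-1}, τ(B_1) = B_0C_{n−1}C_0^{-1}, τ(B_i) = B_{n−i+1}C_{n−i}C_{n−i+1}^{-1} for 2 ≤ i ≤ n−1, τ(C_0) = C_0, τ(C_i) = C_{n−i} for 1 ≤ i ≤ n−1 (indices mod n). Then the fixed field K(A, B_0, …, C_{n−1})^{D_n}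 is rational over k, i.e., isomorphic as a k-algebra to the rational function field k(t_1, …, t_{2n+1}). -/
/-- A generating set of size at most the transcendence degree is algebraically independent. -/
theorem algebraicIndependent_of_adjoin_eq_top {K L : Type*} [Field K] [Field L] [Algebra K L]
    {N : ℕ} (hN : Algebra.trdeg K L = N) {s : Set L} (hs : s.Finite) (hcard : s.ncard ≤ N)
    (hgen : IntermediateField.adjoin K s = ⊤) :
    AlgebraicIndependent K ((↑) : s → L) ∧ s.ncard = N := by
  have halg : Algebra.IsAlgebraic (IntermediateField.adjoin K s) L := by
    rw [hgen]
    exact ⟨fun x => isAlgebraic_algebraMap (⟨x, trivial⟩ : (⊤ : IntermediateField K L))⟩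
  have := IntermediateField.isAlgebraic_adjoin_iff_top.1 halg
  obtain ⟨t, hts, ht⟩ := exists_isTranscendenceBasis_subset (R := K) s
  have hc : t.ncard = N := by
    have := ht.cardinalMk_eq_trdeg
    rw [hN] at this
    simp [Set.ncard, Set.encard, ENat.card, this]
  obtain rfl : t = s := Set.eq_of_subset_of_ncard_le hts (by omega) hs
  exact ⟨ht.1, hc⟩

section SemilinearAction

variable {G k K L : Type*} [Group G] [Field k] [Field K] [Algebra k K]
  [Field L] [Algebra k L] [Algebra K L]

/-- Semilinear descent: a span stable under a semilinear action of a finite group is spanned by a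
linearly independent set of invariants. -/
theorem exists_invariant_linearIndependent_span_eq [Finite G]
    (φ : G →* (K ≃ₐ[k] K)) (hφ : Function.Injective φ) (ρ : G →* (L ≃ₐ[k] L))
    (hρK : ∀ g x, ρ g (algebraMap K L x) = algebraMap K L (φ g x))
    {Y : Set L} (hY : Y.Finite)
    (hstab : ∀ g, ∀ y ∈ Y, ρ g y ∈ Submodule.span K Y) :
    ∃ t : Set L, (∀ x ∈ t, ∀ g, ρ g x = x) ∧ Submodule.span K t = Submodule.span K Y ∧
      LinearIndependent K ((↑) : t → L) ∧ t.Finite ∧ t.ncard ≤ Y.ncard := by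
  have := Fintype.ofFinite G
  have hsmul : ∀ g (a : K) (v : L), ρ g (a • v) = φ g a • ρ g v := fun g a v => by
    simp [Algebra.smul_def, hρK]
  have hstab' : ∀ g, ∀ v ∈ Submodule.span K Y, ρ g v ∈ Submodule.span K Y := by
    intro g v hv
    induction hv using Submodule.span_induction with
    | mem y hy => exact hstab g y hy
    | zero => simp
    | add x y _ _ hx hy => rw [map_add]; exact add_mem hx hy
    | smul a x _ hx => rw [hsmul]; exact Submodule.smul_mem _ _ hx
  let I : Set L := {v | v ∈ Submodule.span K Y ∧ ∀ g, ρ g v = v}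
  have hspan : Submodule.span K I = Submodule.span K Y := by
    refine le_antisymm (Submodule.span_le.2 fun v hv => hv.1) fun v hv => ?_
    by_contra hvI
    obtain ⟨f, hfv, hfI⟩ := Submodule.exists_le_ker_of_notMem hvI
    have hli : LinearIndependent K fun g : G => ((φ g : K →* K) : K → K) :=
      (linearIndependent_monoidHom K K).comp (fun g : G => (φ g : K →* K)) fun g h hgh =>
        hφ (AlgEquiv.ext fun x => DFunLike.congr_fun hgh x)
    have hzero := Fintype.linearIndependent_iff.1 hli (fun g => f (ρ g v)) (by
      ext a
      have hmem : ∑ g, ρ g (a • v) ∈ Submodule.span K I := by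
        refine Submodule.subset_span ⟨?_, fun h => ?_⟩
        · exact sum_mem fun g _ => hstab' g _ (Submodule.smul_mem _ _ hv)
        · rw [map_sum]
          refine Fintype.sum_equiv (Equiv.mulLeft h) _ _ fun g => ?_
          simp [map_mul]
      have := hfI hmem
      simpa [hsmul, mul_comm] using this) 1
    simp at hzero
    exact hfv hzero
  obtain ⟨t, htI, htspan, hli⟩ := exists_linearIndependent K I
  have hfin : Module.Finite K (Submodule.span K Y) := Module.Finite.span_of_finite K hY
  have htY : Submodule.span K t = Submodule.span K Y := htspan.trans hspan
  have htfin : t.Finite := by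
    have : Module.Finite K (Submodule.span K (Set.range ((↑) : t → L))) := by
      rwa [Subtype.range_coe, htY]
    exact Module.Finite.finite_basis (Module.Basis.span hli)
  refine ⟨t, fun x hx => (htI hx).2, htY, hli, htfin, ?_⟩
  have := htfin.fintype
  have := hY.fintype
  rw [Set.ncard_eq_toFinset_card', Set.ncard_eq_toFinset_card', ← finrank_span_set_eq_card hli, htY]
  exact finrank_span_le_card Y

variable [IsScalarTower k K L] [FiniteDimensional k K] [IsGalois k K]

/-- The fixed field of a semilinear action is generated over the base field by any set of
invariants generating the whole field over `K`. -/
theorem fixedField_range_eq_adjoin (φ : G ≃* (K ≃ₐ[k] K)) (ρ : G →* (L ≃ₐ[k] L))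
    (hρK : ∀ g x, ρ g (algebraMap K L x) = algebraMap K L (φ g x))
    {t : Set L} (ht : ∀ x ∈ t, ∀ g, ρ g x = x) (hgen : IntermediateField.adjoin K t = ⊤) :
    IntermediateField.fixedField ρ.range = IntermediateField.adjoin k t := by
  have := Fintype.ofEquiv _ φ.symm.toEquiv
  set E := IntermediateField.adjoin k t
  have hE : E ≤ IntermediateField.fixedField ρ.range := by
    rw [IntermediateField.adjoin_le_iff]
    rintro x hx
    rw [SetLike.mem_coe, IntermediateField.mem_fixedField_iff]
    rintro _ ⟨g, rfl⟩
    exact ht x hx g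
  have hEfix : ∀ e ∈ E, ∀ g, ρ g e = e := fun e he g =>
    (IntermediateField.mem_fixedField_iff _ _).1 (hE he) _ ⟨g, rfl⟩
  refine le_antisymm (fun x hx => ?_) hE
  rw [IntermediateField.mem_fixedField_iff] at hx
  have htrace : ∀ a : K, ∑ g, ρ g (algebraMap K L a) = algebraMap k L (Algebra.trace k K a) := by
    intro a
    rw [IsScalarTower.algebraMap_apply k K L, trace_eq_sum_automorphisms, map_sum]
    exact Fintype.sum_equiv φ.toEquiv _ _ fun g => hρK g a
  set M := (IsScalarTower.toAlgHom k K L).fieldRange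
  have : Algebra.IsAlgebraic k M :=
    (AlgEquiv.ofInjectiveField (IsScalarTower.toAlgHom k K L)).isAlgebraic
  have htop : E ⊔ M = ⊤ := by
    rw [eq_top_iff]
    rintro y -
    have hy : y ∈ IntermediateField.adjoin K t := hgen ▸ IntermediateField.mem_top
    induction hy using IntermediateField.adjoin_induction with
    | mem x hx => exact (le_sup_left : E ≤ E ⊔ M) (IntermediateField.subset_adjoin _ _ hx)
    | algebraMap a => exact (le_sup_right : M ≤ E ⊔ M) ⟨a, rfl⟩
    | add x y _ _ hx hy => exact add_mem hx hy
    | inv x _ hx => exact inv_mem hx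
    | mul x y _ _ hx hy => exact mul_mem hx hy
  have hsum : ∀ y : L, ∑ g, ρ g y ∈ E := by
    intro y
    have hy : y ∈ Subalgebra.toSubmodule E.toSubalgebra * Subalgebra.toSubmodule M.toSubalgebra := by
      rw [Subalgebra.mul_toSubmodule, ← IntermediateField.sup_toSubalgebra_of_isAlgebraic_right, htop]
      trivial
    induction hy using Submodule.mul_induction_on' with
    | mem_mul_mem e he m hm =>
      obtain ⟨a, rfl⟩ := hm
      have : ∑ g, ρ g (e * algebraMap K L a) = e * algebraMap k L (Algebra.trace k K a) := by
        rw [← htrace, Finset.mul_sum]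
        exact Finset.sum_congr rfl fun g _ => by rw [map_mul, hEfix e he]
      exact this ▸ mul_mem he (E.algebraMap_mem _)
    | add x _ y _ hx hy =>
      simp only [map_add, Finset.sum_add_distrib]
      exact add_mem hx hy
  obtain ⟨c, hc⟩ := Algebra.trace_surjective k K 1
  have hxc : ∑ g, ρ g (x * algebraMap K L c) = x := by
    have : ∀ g, ρ g (x * algebraMap K L c) = x * ρ g (algebraMap K L c) := fun g => by
      rw [map_mul, hx _ ⟨g, rfl⟩]
    rw [Finset.sum_congr rfl fun g _ => this g, ← Finset.mul_sum, htrace, hc, map_one, mul_one]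
  exact hxc ▸ hsum _

/-- If `L / K` is purely transcendental, generated by a minimal number of elements whose
`K`-span is stable under a semilinear action of `Gal(K/k)`, then the fixed field is rational. -/
theorem nonempty_fixedField_equiv_of_stable_span (φ : G ≃* (K ≃ₐ[k] K)) (ρ : G →* (L ≃ₐ[k] L))
    (hρK : ∀ g x, ρ g (algebraMap K L x) = algebraMap K L (φ g x))
    {N : ℕ} (hN : Algebra.trdeg K L = N) {Y : Set L} (hY : Y.Finite) (hcard : Y.ncard ≤ N)
    (hgen : IntermediateField.adjoin K Y = ⊤)
    (hstab : ∀ g, ∀ y ∈ Y, ρ g y ∈ Submodule.span K Y) :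
    Nonempty (IntermediateField.fixedField ρ.range ≃ₐ[k]
      FractionRing (MvPolynomial (Fin N) k)) := by
  have := Finite.of_equiv _ φ.symm.toEquiv
  obtain ⟨t, ht, hspan, -, htfin, htcard⟩ :=
    exists_invariant_linearIndependent_span_eq φ.toMonoidHom φ.injective ρ hρK hY hstab
  have hspan_le : Submodule.span K t ≤
      Subalgebra.toSubmodule (IntermediateField.adjoin K t).toSubalgebra :=
    Submodule.span_le.2 (IntermediateField.subset_adjoin K t)
  have htgen : IntermediateField.adjoin K t = ⊤ := by
    rw [eq_top_iff, ← hgen, IntermediateField.adjoin_le_iff]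
    exact fun y hy => hspan_le (hspan ▸ Submodule.subset_span hy)
  obtain ⟨hind, hcard'⟩ :=
    algebraicIndependent_of_adjoin_eq_top hN htfin (htcard.trans hcard) htgen
  have := htfin.to_subtype
  have hindk := hind.restrictScalars (algebraMap k K).injective
  let e : t ≃ Fin N := Finite.equivFinOfCardEq hcard'
  have hfix := fixedField_range_eq_adjoin φ ρ hρK ht htgen
  rw [← Subtype.range_coe (s := t)] at hfix
  exact ⟨(IntermediateField.equivOfEq hfix).trans <| hindk.aevalEquivField.symm.trans <|
    IsFractionRing.algEquivOfAlgEquiv (MvPolynomial.renameEquiv k e)⟩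

end SemilinearAction

theorem DihedralGroup.induction_on_generators {n : ℕ} [NeZero n] {p : DihedralGroup n → Prop}
    (one : p 1) (mul : ∀ g h, p g → p h → p (g * h)) (r_one : p (DihedralGroup.r 1))
    (sr_zero : p (DihedralGroup.sr 0)) (g : DihedralGroup n) : p g := by
  have hr : ∀ i : ZMod n, p (DihedralGroup.r i) := fun i => by
    have hpow : ∀ m : ℕ, p (DihedralGroup.r 1 ^ m) := fun m => by
      induction m with
      | zero => simpa using one
      | succ m ih => exact pow_succ (DihedralGroup.r (1 : ZMod n)) m ▸ mul _ _ ih r_one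
    simpa using hpow i.val
  rcases g with i | i
  · exact hr i
  · simpa using mul _ _ sr_zero (hr i)


/-- let `n ≥ 3` be odd and `K/k` a finite Galois extension with
`Gal(K/k) ≅ D_n` (via `φ`).  Let `L = K(A, B_0, …, B_{n-1}, C_0, …, C_{n-1})` be a
rational function field in `2n+1` variables over `K` (the variables are
algebraically independent over `K` and generate `L` as a field over `K`), and let
`D_n` act on `L` by `k`-algebra automorphisms `ρ` acting on `K` through the Galois
identification and on the variables by
`σ : A ↦ A, B_i ↦ B_{i+1}, C_i ↦ C_{i+1}` and
`τ : A ↦ A⁻¹B_0⋯B_{n-1}, B_i ↦ B_{1-i}C_{-i}C_{1-i}⁻¹, C_i ↦ C_{-i}`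
(indices mod `n`; these are the formulas for the multiplicative action on
`K(R^{ab})`).  Then the fixed field `L^{D_n}` is rational over `k`: it is
`k`-algebra isomorphic to the rational function field in `2n+1` variables over
`k`. -/
theorem fixedField_relationModule_rational (n : ℕ) (hn : 3 ≤ n) (hodd : Odd n)
    [NeZero n]
    (k K : Type) [Field k] [Field K] [Algebra k K]
    [FiniteDimensional k K] [IsGalois k K]
    (φ : DihedralGroup n ≃* (K ≃ₐ[k] K))
    (L : Type) [Field L] [Algebra k L] [Algebra K L] [IsScalarTower k K L]
    (A : L) (B C : ZMod n → L)
    (hind : AlgebraicIndependent K (Sum.elim (fun _ : Unit => A) (Sum.elim B C)))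
    (hgen : IntermediateField.adjoin K
      (Set.range (Sum.elim (fun _ : Unit => A) (Sum.elim B C))) = ⊤)
    (ρ : DihedralGroup n →* (L ≃ₐ[k] L))
    (hρK : ∀ (g : DihedralGroup n) (x : K),
      ρ g (algebraMap K L x) = algebraMap K L (φ g x))
    (hσA : ρ (DihedralGroup.r 1) A = A)
    (hσB : ∀ i : ZMod n, ρ (DihedralGroup.r 1) (B i) = B (i + 1))
    (hσC : ∀ i : ZMod n, ρ (DihedralGroup.r 1) (C i) = C (i + 1))
    (hτA : ρ (DihedralGroup.sr 0) A = A⁻¹ * ∏ i : ZMod n, B i)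
    (hτB : ∀ i : ZMod n,
      ρ (DihedralGroup.sr 0) (B i) = B (1 - i) * C (-i) * (C (1 - i))⁻¹)
    (hτC : ∀ i : ZMod n, ρ (DihedralGroup.sr 0) (C i) = C (-i)) :
    Nonempty (↥(IntermediateField.fixedField ρ.range) ≃ₐ[k]
      FractionRing (MvPolynomial (Fin (2 * n + 1)) k)) := by
  obtain ⟨t, hn_def⟩ := hodd
  have hsmul : ∀ g (a : K) (v : L), ρ g (a • v) = φ g a • ρ g v := fun g a v => by
    simp [Algebra.smul_def, hρK]
  have hne := hind.ne_zero
  have hA : A ≠ 0 := hne (Sum.inl ())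
  have hB : ∀ i, B i ≠ 0 := fun i => hne (Sum.inr (Sum.inl i))
  have hC : ∀ i, C i ≠ 0 := fun i => hne (Sum.inr (Sum.inr i))
  have hstab_of_gens : ∀ Y : Set L,
      (∀ y ∈ Y, ρ (DihedralGroup.r 1) y ∈ Submodule.span K Y) →
      (∀ y ∈ Y, ρ (DihedralGroup.sr 0) y ∈ Submodule.span K Y) →
      ∀ g, ∀ y ∈ Y, ρ g y ∈ Submodule.span K Y := by
    intro Y hr hs g
    have hext : ∀ g, (∀ y ∈ Y, ρ g y ∈ Submodule.span K Y) →
        ∀ v ∈ Submodule.span K Y, ρ g v ∈ Submodule.span K Y := by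
      intro g hg v hv
      induction hv using Submodule.span_induction with
      | mem y hy => exact hg y hy
      | zero => simp
      | add x y _ _ hx hy => rw [map_add]; exact add_mem hx hy
      | smul a x _ hx => rw [hsmul]; exact Submodule.smul_mem _ _ hx
    induction g using DihedralGroup.induction_on_generators with
    | one => exact fun y hy => by simpa using Submodule.subset_span hy
    | mul g h hg hh =>
      exact fun y hy => by
        rw [map_mul]
        exact hext g hg _ (hh y hy)
    | r_one => exact hr
    | sr_zero => exact hs
  have htrdeg : Algebra.trdeg K L = (2 * n + 1 : ℕ) := by
    have halg : Algebra.IsAlgebraic (IntermediateField.adjoin K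
        (Set.range (Sum.elim (fun _ : Unit => A) (Sum.elim B C)))) L := by
      rw [hgen]
      exact ⟨fun x => isAlgebraic_algebraMap (⟨x, trivial⟩ : (⊤ : IntermediateField K L))⟩
    have := (hind.isTranscendenceBasis_iff_isAlgebraic.2
      (IntermediateField.isAlgebraic_adjoin_iff_top.1 halg)).cardinalMk_eq_trdeg
    rw [← this, Cardinal.mk_fintype]
    congr 1
    simp
    ring
  let h : ZMod n := t + 1
  have hh : 1 - h = h := by
    have : ((2 * t + 1 : ℕ) : ZMod n) = 0 := hn_def ▸ ZMod.natCast_self n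
    push_cast at this
    linear_combination -this
  let β : ZMod n → L := fun i => B (i + h) * C (i + h - 1)
  have hβ : ∀ i, β i ≠ 0 := fun i => mul_ne_zero (hB _) (hC _)
  have hσβ : ∀ i, ρ (DihedralGroup.r 1) (β i) = β (i + 1) := fun i => by
    simp only [β, map_mul, hσB, hσC]
    ring_nf
  have hτβ : ∀ i, ρ (DihedralGroup.sr 0) (β i) = β (-i) := fun i => by
    have h1 : 1 - (i + h) = -i + h := by linear_combination hh
    have h2 : -(i + h - 1) = -i + h := by linear_combination hh
    have h3 : -(i + h) = -i + h - 1 := by linear_combination hh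
    simp only [β, map_mul, hτB, hτC, h1, h2, h3]
    field_simp [hC]
  let δ : ZMod n → L := fun i => C i / β i
  have hδ : ∀ i, δ i ≠ 0 := fun i => div_ne_zero (hC _) (hβ _)
  have hσδ : ∀ i, ρ (DihedralGroup.r 1) (δ i) = δ (i + 1) := fun i => by
    simp only [δ, map_div₀, hσβ, hσC]
  have hτδ : ∀ i, ρ (DihedralGroup.sr 0) (δ i) = δ (-i) := fun i => by
    simp only [δ, map_div₀, hτβ, hτC]
  have hprodδ : ∏ i, δ i ≠ 0 := Finset.prod_ne_zero_iff.2 fun i _ => hδ i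
  have hτA' : ρ (DihedralGroup.sr 0) A = A⁻¹ * (∏ i, δ i)⁻¹ := by
    have h1 : ∏ i, β i = (∏ i, B i) * ∏ i, C i := by
      simp only [β, Finset.prod_mul_distrib]
      congr 1
      · exact Fintype.prod_equiv (Equiv.addRight h) _ _ fun i => rfl
      · exact Fintype.prod_equiv (Equiv.addRight (h - 1)) _ _ fun i => by
          simp [add_sub_assoc]
    have h2 : ∏ i, C i ≠ 0 := Finset.prod_ne_zero_iff.2 fun i _ => hC i
    rw [hτA, Finset.prod_div_distrib, h1]
    field_simp
  obtain ⟨s, hsinv, hsspan, hsli, hsfin, hscard⟩ :=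
    exists_invariant_linearIndependent_span_eq φ.toMonoidHom φ.injective ρ hρK
      (Set.finite_range β) (hstab_of_gens _
        (by rintro _ ⟨i, rfl⟩; rw [hσβ]; exact Submodule.subset_span ⟨_, rfl⟩)
        (by rintro _ ⟨i, rfl⟩; rw [hτβ]; exact Submodule.subset_span ⟨_, rfl⟩))
  obtain ⟨w, hws⟩ : s.Nonempty := by
    rw [Set.nonempty_iff_ne_empty]
    rintro rfl
    rw [Submodule.span_empty] at hsspan
    have : β 0 ∈ (⊥ : Submodule K L) := hsspan ▸ Submodule.subset_span ⟨0, rfl⟩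
    exact hβ 0 (by simpa using this)
  have hw : w ≠ 0 := hsli.ne_zero ⟨w, hws⟩
  have hwinv := hsinv w hws
  let P : L := A / w ^ t
  let Q : L := A⁻¹ * (∏ i, δ i)⁻¹ / w ^ t
  let D : ZMod n → L := fun i => δ i * w
  have hτP : ρ (DihedralGroup.sr 0) P = Q := by simp only [P, Q, map_div₀, map_pow, hwinv, hτA']
  have hττ : ∀ x, ρ (DihedralGroup.sr 0) (ρ (DihedralGroup.sr 0) x) = x := fun x => by
    rw [← AlgEquiv.mul_apply, ← map_mul]
    simp
  have hτQ : ρ (DihedralGroup.sr 0) Q = P := by rw [← hτP, hττ]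
  have hσP : ρ (DihedralGroup.r 1) P = P := by simp only [P, map_div₀, map_pow, hwinv, hσA]
  have hσQ : ρ (DihedralGroup.r 1) Q = Q := by
    have : ∏ i, δ (i + 1) = ∏ i, δ i :=
      Fintype.prod_equiv (Equiv.addRight (1 : ZMod n)) _ _ fun i => rfl
    simp only [Q, map_div₀, map_mul, map_inv₀, map_prod, map_pow, hwinv, hσA, hσδ, this]
  have hwPQD : P * Q * ∏ i, D i = w := by
    have : ∏ i, D i = (∏ i, δ i) * w ^ n := by
      simp only [D, Finset.prod_mul_distrib, Finset.prod_const, Finset.card_univ, ZMod.card]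
    rw [this]
    simp only [P, Q, hn_def]
    field_simp
    ring
  let Y : Set L := (s \ {w}) ∪ (Set.range D ∪ {P, Q})
  have hDY : ∀ i, D i ∈ Y := fun i => Or.inr (Or.inl ⟨i, rfl⟩)
  have hPY : P ∈ Y := Or.inr (Or.inr (Or.inl rfl))
  have hQY : Q ∈ Y := Or.inr (Or.inr (Or.inr rfl))
  have hncard_range : ∀ f : ZMod n → L, (Set.range f).ncard ≤ n := fun f => by
    rw [← Set.image_univ]
    refine (Set.ncard_image_le Set.finite_univ).trans ?_
    simp [Set.ncard_univ]
  refine nonempty_fixedField_equiv_of_stable_span φ ρ hρK htrdeg (Y := Y) ?_ ?_ ?_ ?_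
  · exact hsfin.sdiff.union ((Set.finite_range D).union (by simp))
  · have h1 : Y.ncard ≤ _ := Set.ncard_union_le (s \ {w}) (Set.range D ∪ {P, Q})
    have h2 := Set.ncard_union_le (Set.range D) {P, Q}
    have h3 := Set.ncard_sdiff_singleton_lt_of_mem hws hsfin
    have h4 := hncard_range D
    have h5 := Set.ncard_insert_le P {Q}
    have h6 := hscard.trans (hncard_range β)
    rw [Set.ncard_singleton] at h5
    omega
  · set F := IntermediateField.adjoin K Y
    have hYF : ∀ y ∈ Y, y ∈ F := fun y hy => IntermediateField.subset_adjoin K Y hy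
    have hwF : w ∈ F := hwPQD ▸ mul_mem (mul_mem (hYF _ hPY) (hYF _ hQY))
      (prod_mem fun i _ => hYF _ (hDY i))
    have hsF : Submodule.span K s ≤ Subalgebra.toSubmodule F.toSubalgebra := by
      refine Submodule.span_le.2 fun x hx => ?_
      by_cases hxw : x = w
      · exact hxw ▸ hwF
      · exact hYF x (Or.inl ⟨hx, hxw⟩)
    have hβF : ∀ i, β i ∈ F := fun i => hsF (hsspan ▸ Submodule.subset_span ⟨i, rfl⟩)
    have hCF : ∀ i, C i ∈ F := fun i => by
      have : C i = D i / w * β i := by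
        simp only [D, δ]
        field_simp [hβ i]
      exact this ▸ mul_mem (div_mem (hYF _ (hDY i)) hwF) (hβF i)
    have hBF : ∀ i, B i ∈ F := fun i => by
      have : B i = β (i - h) / C (i - 1) := by
        simp only [β, sub_add_cancel]
        rw [mul_div_cancel_right₀ _ (hC _)]
      exact this ▸ div_mem (hβF _) (hCF _)
    have hAF : A ∈ F := by
      have : A = P * w ^ t := by
        simp only [P]
        field_simp
      exact this ▸ mul_mem (hYF _ hPY) (pow_mem hwF t)
    rw [eq_top_iff, ← hgen, IntermediateField.adjoin_le_iff]
    rintro _ ⟨i | i | i, rfl⟩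
    · exact hAF
    · exact hBF i
    · exact hCF i
  · refine hstab_of_gens Y ?_ ?_
    · rintro y (hy | ⟨i, rfl⟩ | rfl | rfl)
      · rw [hsinv y hy.1]
        exact Submodule.subset_span (Or.inl hy)
      · simp only [D, map_mul, hσδ, hwinv]
        exact Submodule.subset_span (hDY (i + 1))
      · exact hσP.symm ▸ Submodule.subset_span hPY
      · exact hσQ.symm ▸ Submodule.subset_span hQY
    · rintro y (hy | ⟨i, rfl⟩ | rfl | rfl)
      · rw [hsinv y hy.1]
        exact Submodule.subset_span (Or.inl hy)
      · simp only [D, map_mul, hτδ, hwinv]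
        exact Submodule.subset_span (hDY (-i))
      · exact hτP.symm ▸ Submodule.subset_span hQY
      · exact hτQ.symm ▸ Submodule.subset_span hPY
end
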